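/- arXiv:2601.15107 — 3 statements merged into one kernel-verified Lean document; each statement's English description precedes it below -/
import Mathlib

section
/- Assume (H3) and 0 < μ̃ < ∞. If h(s_*) < (1/s_*) ∫₀^{s_*} h(t) dt, then there exists c_F ∈ [h_m − (p')^{1/p'} p^{1/p} μ̃^{1/p'}, h(s_*)] such that, for every c ∈ ℝ, the boundary value problem on [0, s_*] admits a (necessarily unique) positive solution if and only if c ≤ c_F. If instead h(s_*) ≥ (1/s_*) ∫₀^{s_*} h(t) dt, the same conclusion holds with c_F ∈ [h_m − (p')^{1/p'} p^{1/p} μ̃^{1/p'}, (1/s_*) ∫₀^{s_*} h(t) dt). -/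
open MeasureTheory Set Filter Topology intervalIntegral

noncomputable section

/-- A Carathéodory solution on `[a,b]` of the ODE
`y'(t) = p' * ((c - h t) * (y⁺ t)^(1/p) - f t)`, in integral form. -/
def IsCaraSol (p p' : ℝ) (h f : ℝ → ℝ) (c a b : ℝ) (y : ℝ → ℝ) : Prop :=
  ContinuousOn y (Set.Icc a b) ∧
  ∀ t ∈ Set.Icc a b,
    y t = y a + ∫ u in a..t, p' * ((c - h u) * (max (y u) 0) ^ (1 / p) - f u)

/-- A positive solution of the boundary value problem on `[a,b]`. -/
def IsPosBVPSol (p p' : ℝ) (h f : ℝ → ℝ) (c a b : ℝ) (y : ℝ → ℝ) : Prop :=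
  IsCaraSol p p' h f c a b y ∧ y a = 0 ∧ y b = 0 ∧ ∀ t ∈ Set.Ioo a b, 0 < y t

open scoped NNReal BoundedContinuousFunction

lemma intervalIntegrable_of_abs_le {F : ℝ → ℝ} {L : ℝ}
    (hm : AEStronglyMeasurable F volume) (hb : ∀ t, |F t| ≤ L) (a b : ℝ) :
    IntervalIntegrable F volume a b :=
  (intervalIntegrable_const (c := L)).mono_fun hm.restrict
    (Eventually.of_forall fun t => by simpa using (hb t).trans (le_abs_self L))

lemma lipschitzWith_primitive_max {F : ℝ → ℝ} {L : ℝ≥0}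
    (hm : AEStronglyMeasurable F volume) (hb : ∀ t, |F t| ≤ L) :
    LipschitzWith L fun t => ∫ u in (0 : ℝ)..max t 0, F u := by
  refine LipschitzWith.of_dist_le_mul fun a b => ?_
  have hi := intervalIntegrable_of_abs_le hm hb
  rw [Real.dist_eq, Real.dist_eq, integral_interval_sub_left (hi _ _) (hi _ _)]
  refine (norm_integral_le_of_norm_le_const (C := L) (f := F) fun x _ => hb x).trans ?_
  exact mul_le_mul_of_nonneg_left (abs_max_sub_max_le_abs a b 0) L.2

lemma exists_delayed_solution {L : ℝ≥0} {Φ : ℝ → ℝ → ℝ}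
    (hm : ∀ y : ℝ → ℝ, Continuous y → AEStronglyMeasurable (fun t => Φ t (y t)) volume)
    (hb : ∀ t x, |Φ t x| ≤ L) (s : ℝ) {δ : ℝ} (hδ : 0 < δ) :
    ∃ y : ℝ → ℝ, LipschitzWith L y ∧
      ∀ t ∈ Icc 0 s, y t = ∫ u in (0 : ℝ)..t, Φ u (y (u - δ)) := by
  let T : (ℝ → ℝ) → ℝ → ℝ := fun y t => ∫ u in (0 : ℝ)..max t 0, Φ u (y (u - δ))
  have hlip : ∀ n, LipschitzWith L (T^[n] 0) := by
    intro n
    induction n with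
    | zero => exact (LipschitzWith.const (0 : ℝ)).weaken zero_le
    | succ n ih =>
      rw [Function.iterate_succ_apply']
      exact lipschitzWith_primitive_max
        (hm (fun u => T^[n] 0 (u - δ)) (ih.continuous.comp (by fun_prop))) fun t => hb _ _
  have hstab : ∀ n : ℕ, ∀ t ≤ n * δ, T^[n + 1] 0 t = T^[n] 0 t := by
    intro n
    induction n with
    | zero =>
      intro t ht
      have : max t 0 = 0 := max_eq_right (by simpa using ht)
      simp [T, this]
    | succ n ih =>
      intro t ht
      rw [Function.iterate_succ_apply', Function.iterate_succ_apply' T n]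
      refine integral_congr fun u hu => ?_
      rw [uIcc_of_le (le_max_right _ _)] at hu
      have hu' : u ≤ (n + 1 : ℕ) * δ := hu.2.trans (max_le ht (by positivity))
      have := ih (u - δ) (by push_cast at hu'; linarith)
      rw [Function.iterate_succ_apply'] at this
      exact congrArg (Φ u) this
  obtain ⟨n, hn⟩ := exists_nat_ge (s / δ)
  refine ⟨T^[n] 0, hlip n, fun t ht => ?_⟩
  have h1 : t ≤ n * δ := ht.2.trans ((div_le_iff₀ hδ).1 hn)
  rw [← hstab n t h1, Function.iterate_succ_apply']
  simp [T, max_eq_left ht.1]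

/-- Carathéodory's existence theorem for a bounded right-hand side. -/
lemma exists_caratheodory_solution {L : ℝ≥0} {Φ : ℝ → ℝ → ℝ}
    (hm : ∀ y : ℝ → ℝ, Continuous y → AEStronglyMeasurable (fun t => Φ t (y t)) volume)
    (hc : ∀ t, Continuous (Φ t)) (hb : ∀ t x, |Φ t x| ≤ L) {s : ℝ} (hs : 0 < s) :
    ∃ y : ℝ → ℝ, Continuous y ∧ ∀ t ∈ Icc 0 s, y t = ∫ u in (0 : ℝ)..t, Φ u (y u) := by
  choose Y hYlip hY using fun n : ℕ =>
    exists_delayed_solution hm hb s (δ := 1 / ((n : ℝ) + 1)) (by positivity)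
  have hY0 : ∀ n, Y n 0 = 0 := fun n => by simpa using hY n 0 ⟨le_rfl, hs.le⟩
  let A : Set (Icc (0 : ℝ) s →ᵇ ℝ) :=
    {f | LipschitzWith L f ∧ ∀ x, f x ∈ Icc (-(L * s)) (L * s)}
  have hAclosed : IsClosed A := by
    have h1 : A = (⋂ x, ⋂ y, {f : Icc (0 : ℝ) s →ᵇ ℝ | dist (f x) (f y) ≤ L * dist x y}) ∩
        ⋂ x, {f : Icc (0 : ℝ) s →ᵇ ℝ | f x ∈ Icc (-(L * s)) (L * s)} := by
      ext f
      simp only [A, lipschitzWith_iff_dist_le_mul, mem_inter_iff, mem_iInter, mem_ofPred_eq]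
    rw [h1]
    refine IsClosed.inter (isClosed_iInter fun x => isClosed_iInter fun y =>
      isClosed_le ?_ continuous_const) (isClosed_iInter fun x => isClosed_Icc.preimage ?_)
    · exact (continuous_eval_const (x := x)).dist
        (continuous_eval_const (x := y))
    · exact continuous_eval_const (x := x)
  have hA : IsCompact A := by
    refine BoundedContinuousFunction.arzela_ascoli₂ _ isCompact_Icc A hAclosed
      (fun f x hf => hf.2 x) ?_
    exact (LipschitzWith.uniformEquicontinuous _ L fun f => f.2.1).equicontinuous
  let Z : ℕ → (Icc (0 : ℝ) s →ᵇ ℝ) := fun n =>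
    BoundedContinuousFunction.mkOfCompact ⟨fun x => Y n x, (hYlip n).continuous.comp (by fun_prop)⟩
  have hZ : ∀ n, Z n ∈ A := by
    intro n
    refine ⟨LipschitzWith.of_dist_le_mul fun x y => (hYlip n).dist_le_mul x y, fun x => ?_⟩
    have h1 := (hYlip n).dist_le_mul x 0
    rw [hY0, Real.dist_eq, Real.dist_eq, sub_zero, sub_zero, abs_of_nonneg x.2.1] at h1
    exact abs_le.1 (h1.trans (by gcongr; exact x.2.2))
  obtain ⟨W, -, φ, hφ, hW⟩ := hA.tendsto_subseq hZ
  have hpt : ∀ u ∈ Icc 0 s, Tendsto (fun n => Y (φ n) u) atTop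
      (𝓝 (IccExtend hs.le W u)) := by
    intro u hu
    rw [IccExtend_of_mem hs.le W hu]
    exact ((continuous_eval_const (x := (⟨u, hu⟩ : Icc (0 : ℝ) s))).tendsto
      W).comp hW
  have hδ : Tendsto (fun n => 1 / ((φ n : ℝ) + 1)) atTop (𝓝 0) :=
    tendsto_one_div_add_atTop_nhds_zero_nat.comp hφ.tendsto_atTop
  have hshift : ∀ u ∈ Icc 0 s, Tendsto (fun n => Y (φ n) (u - 1 / ((φ n : ℝ) + 1))) atTop
      (𝓝 (IccExtend hs.le W u)) := by
    intro u hu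
    refine (hpt u hu).congr_dist (squeeze_zero (fun _ => dist_nonneg)
      (fun n => (hYlip (φ n)).dist_le_mul _ _) ?_)
    have : ∀ n, dist u (u - 1 / ((φ n : ℝ) + 1)) = 1 / ((φ n : ℝ) + 1) := fun n => by
      rw [Real.dist_eq, sub_sub_cancel, abs_of_nonneg (by positivity)]
    simp only [this]
    simpa using hδ.const_mul (L : ℝ)
  refine ⟨IccExtend hs.le W, W.continuous.Icc_extend', fun t ht => ?_⟩
  refine tendsto_nhds_unique (hpt t ht) ?_
  have hlim : Tendsto
      (fun n => ∫ u in (0 : ℝ)..t, Φ u (Y (φ n) (u - 1 / ((φ n : ℝ) + 1)))) atTop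
      (𝓝 (∫ u in (0 : ℝ)..t, Φ u (IccExtend hs.le W u))) := by
    refine tendsto_integral_filter_of_dominated_convergence (fun _ => (L : ℝ))
      (Eventually.of_forall fun n => ?_) (Eventually.of_forall fun n =>
        Eventually.of_forall fun u _ => hb _ _) intervalIntegrable_const
      (Eventually.of_forall fun u hu => ?_)
    · exact (hm (fun u => Y (φ n) (u - 1 / ((φ n : ℝ) + 1)))
        ((hYlip _).continuous.comp (by fun_prop))).restrict
    · rw [uIoc_of_le ht.1] at hu
      exact ((hc u).tendsto _).comp (hshift u ⟨hu.1.le, hu.2.trans ht.2⟩)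
  exact hlim.congr fun n => (hY _ t ht).symm

lemma rpow_sub_rpow_eq_integral {F y : ℝ → ℝ} {a b L : ℝ} (hab : a ≤ b)
    (hF : IntervalIntegrable F volume a b) (hL : ∀ t ∈ Icc a b, |F t| ≤ L)
    (hy : ∀ t ∈ Icc a b, y t = y a + ∫ u in a..t, F u) (hpos : ∀ t ∈ Icc a b, 0 < y t) (r : ℝ) :
    y b ^ r - y a ^ r = ∫ u in a..b, r * y u ^ (r - 1) * F u := by
  have hlip : LipschitzOnWith L.toNNReal y (Icc a b) := by
    refine LipschitzOnWith.of_dist_le_mul fun x hx z hz => ?_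
    have hL0 : 0 ≤ L := (abs_nonneg _).trans (hL x hx)
    have hsub : ∀ w ∈ Icc a b, IntervalIntegrable F volume a w := fun w hw =>
      hF.mono_set (by rw [uIcc_of_le hab, uIcc_of_le hw.1]; exact Icc_subset_Icc_right hw.2)
    rw [Real.dist_eq, Real.dist_eq, hy x hx, hy z hz, add_sub_add_left_eq_sub,
      integral_interval_sub_left (hsub x hx) (hsub z hz), Real.coe_toNNReal _ hL0]
    refine norm_integral_le_of_norm_le_const (f := F) fun u hu => hL u ?_
    exact uIcc_subset_Icc hz hx (uIoc_subset_uIcc hu)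
  have hcont : ContinuousOn y (Icc a b) := hlip.continuousOn
  obtain ⟨m, hm, hmin⟩ := isCompact_Icc.exists_isMinOn (nonempty_Icc.2 hab) hcont
  obtain ⟨M, hM, hmax⟩ := isCompact_Icc.exists_isMaxOn (nonempty_Icc.2 hab) hcont
  have hmaps : MapsTo y (Icc a b) (Icc (y m) (y M)) := fun t ht => ⟨hmin ht, hmax ht⟩
  have hsmooth : ContDiffOn ℝ 1 (fun x : ℝ => x ^ r) (Icc (y m) (y M)) := fun x hx =>
    (Real.contDiffAt_rpow_const_of_ne ((hpos m hm).trans_le hx.1).ne').contDiffWithinAt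
  obtain ⟨K, hK⟩ := hsmooth.exists_lipschitzOnWith (by decide) (convex_Icc _ _) isCompact_Icc
  have hac : AbsolutelyContinuousOnInterval (fun t => y t ^ r) a b :=
    LipschitzOnWith.absolutelyContinuousOnInterval (K := K * L.toNNReal)
      (by rw [uIcc_of_le hab]; exact hK.comp hlip hmaps)
  rw [← hac.integral_deriv_eq_sub]
  refine integral_congr_ae ?_
  have hb : ∀ᵐ t : ℝ, t ≠ b := by simp [ae_iff, measure_singleton]
  filter_upwards [hF.ae_hasDerivAt_integral, hb] with t ht htb hmem
  rw [uIoc_of_le hab] at hmem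
  have hIoo : t ∈ Ioo a b := ⟨hmem.1, lt_of_le_of_ne hmem.2 htb⟩
  have hd : HasDerivAt y (F t) t := by
    refine ((ht (by rw [uIcc_of_le hab]; exact Ioo_subset_Icc_self hIoo) a
      left_mem_uIcc).const_add (y a)).congr_of_eventuallyEq ?_
    filter_upwards [Icc_mem_nhds hIoo.1 hIoo.2] with x hx using hy x hx
  rw [(hd.rpow_const (p := r) (Or.inl (hpos t (Ioo_subset_Icc_self hIoo)).ne')).deriv]
  ring

/-- A function vanishing at `0` that grows with slope at most `κ` wherever it is nonnegative. -/
lemma le_mul_of_sub_le_of_nonneg {D : ℝ → ℝ} {s κ : ℝ} (hκ : 0 ≤ κ)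
    (hD : ContinuousOn D (Icc 0 s)) (h0 : D 0 ≤ 0)
    (hinc : ∀ a b, 0 < a → a ≤ b → b < s → (∀ t ∈ Icc a b, 0 ≤ D t) → D b - D a ≤ κ * (b - a)) :
    ∀ t ∈ Icc 0 s, D t ≤ κ * t := by
  have hIoo : ∀ t ∈ Ioo 0 s, D t ≤ κ * t := by
    intro t ht
    by_contra! hlt
    have hpos : 0 < D t := (mul_nonneg hκ ht.1.le).trans_lt hlt
    have hDt : ContinuousOn D (Icc 0 t) := hD.mono (Icc_subset_Icc_right ht.2.le)
    let N : Set ℝ := Icc 0 t ∩ D ⁻¹' Iic 0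
    have hN : IsCompact N :=
      isCompact_Icc.of_isClosed_subset (hDt.preimage_isClosed_of_isClosed isClosed_Icc isClosed_Iic)
        inter_subset_left
    obtain ⟨τ, hτ, hτmax⟩ := hN.exists_isGreatest ⟨0, ⟨le_rfl, ht.1.le⟩, h0⟩
    have hτt : τ < t := lt_of_le_of_ne hτ.1.2 fun h => by
      have := hτ.2
      rw [h] at this
      exact absurd hpos (not_lt.2 this)
    have hDpos : ∀ u ∈ Ioc τ t, 0 ≤ D u := fun u hu => by
      by_contra! hneg
      exact absurd (hτmax ⟨⟨hτ.1.1.trans hu.1.le, hu.2⟩, hneg.le⟩) (not_le.2 hu.1)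
    have hle : ∀ a ∈ Ioc τ t, D t - κ * (t - a) ≤ D a := fun a ha => by
      have := hinc a t (hτ.1.1.trans_lt ha.1) ha.2 ht.2
        fun u hu => hDpos u ⟨ha.1.trans_le hu.1, hu.2⟩
      linarith
    have hlim : Tendsto D (𝓝[Ioc τ t] τ) (𝓝 (D τ)) :=
      (hDt τ hτ.1).mono_left (nhdsWithin_mono _ fun u hu => ⟨hτ.1.1.trans hu.1.le, hu.2⟩)
    have hlim' : Tendsto (fun a => D t - κ * (t - a)) (𝓝[Ioc τ t] τ) (𝓝 (D t - κ * (t - τ))) :=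
      ((by fun_prop : Continuous fun a => D t - κ * (t - a)).tendsto τ).mono_left nhdsWithin_le_nhds
    have : (𝓝[Ioc τ t] τ).NeBot := by
      rw [← mem_closure_iff_nhdsWithin_neBot, closure_Ioc hτt.ne]
      exact ⟨le_rfl, hτt.le⟩
    have h1 : D t - κ * (t - τ) ≤ D τ :=
      le_of_tendsto_of_tendsto hlim' hlim (eventually_mem_nhdsWithin.mono hle)
    have h2 : D τ ≤ 0 := hτ.2
    nlinarith [mul_nonneg hκ hτ.1.1]
  intro t ht
  have hs0 : 0 ≤ s := ht.1.trans ht.2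
  rcases hs0.eq_or_lt with h | h
  · subst h
    have : t = 0 := le_antisymm ht.2 ht.1
    simpa [this] using h0
  · have hcl : closure (Ioo 0 s) = Icc 0 s := closure_Ioo h.ne
    rw [← hcl] at ht hD
    exact le_on_closure hIoo hD (by fun_prop) ht

/-- The right-hand side of the ODE along a trajectory `y`. -/
def odeRhs (p p' : ℝ) (h f : ℝ → ℝ) (c : ℝ) (y : ℝ → ℝ) (u : ℝ) : ℝ :=
  p' * ((c - h u) * (max (y u) 0) ^ (1 / p) - f u)

/-- The hypotheses on `h` and `f` over `[0, s]` used below, with explicit bounds `M` and `G`. -/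
structure NegativeReaction (p p' s M G : ℝ) (h f : ℝ → ℝ) : Prop where
  one_lt : 1 < p
  conj : p' = p / (p - 1)
  pos : 0 < s
  meas : Measurable h
  abs_le : ∀ t ∈ Icc 0 s, |h t| ≤ M
  aesm : AEStronglyMeasurable f (volume.restrict (Ioo 0 s))
  neg : ∀ t ∈ Ioo 0 s, f t < 0
  neg_le : ∀ t ∈ Ioo 0 s, -f t ≤ G
  usc : UpperSemicontinuousOn f (Ioo 0 s)

namespace NegativeReaction

variable {p p' s M G : ℝ} {h f : ℝ → ℝ} {c : ℝ} {y : ℝ → ℝ}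

lemma p_pos (H : NegativeReaction p p' s M G h f) : 0 < p := zero_lt_one.trans H.one_lt

lemma conj_pos (H : NegativeReaction p p' s M G h f) : 0 < p' := by
  rw [H.conj]
  exact div_pos H.p_pos (sub_pos.2 H.one_lt)

lemma one_div_conj (H : NegativeReaction p p' s M G h f) : 1 / p' = 1 - 1 / p := by
  have h1 := H.p_pos
  have h2 : p - 1 ≠ 0 := (sub_pos.2 H.one_lt).ne'
  rw [H.conj]
  field_simp

lemma M_nonneg (H : NegativeReaction p p' s M G h f) : 0 ≤ M :=
  (abs_nonneg _).trans (H.abs_le 0 ⟨le_rfl, H.pos.le⟩)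

lemma G_pos (H : NegativeReaction p p' s M G h f) : 0 < G := by
  have hm : s / 2 ∈ Ioo 0 s := ⟨half_pos H.pos, half_lt_self H.pos⟩
  linarith [H.neg _ hm, H.neg_le _ hm]

lemma abs_rhs_le (H : NegativeReaction p p' s M G h f) (c : ℝ) {x B t : ℝ} (ht : t ∈ Ioo 0 s)
    (hx : 0 ≤ x) (hxB : x ≤ B) :
    |p' * ((c - h t) * x ^ (1 / p) - f t)| ≤ p' * ((|c| + M) * B ^ (1 / p) + G) := by
  have hp := H.p_pos
  rw [abs_mul, abs_of_pos H.conj_pos]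
  refine mul_le_mul_of_nonneg_left ?_ H.conj_pos.le
  refine (abs_sub _ _).trans (add_le_add ?_ ?_)
  · rw [abs_mul, abs_of_nonneg (Real.rpow_nonneg hx _)]
    refine mul_le_mul ((abs_sub _ _).trans ?_) (Real.rpow_le_rpow hx hxB (by positivity))
      (Real.rpow_nonneg hx _) (add_nonneg (abs_nonneg _) H.M_nonneg)
    exact add_le_add le_rfl (H.abs_le t (Ioo_subset_Icc_self ht))
  · rw [abs_of_neg (H.neg t ht)]
    exact H.neg_le t ht

lemma exists_abs_odeRhs_le (H : NegativeReaction p p' s M G h f) (c : ℝ)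
    (hy : ContinuousOn y (Icc 0 s)) : ∃ L, ∀ t ∈ Ioo 0 s, |odeRhs p p' h f c y t| ≤ L := by
  obtain ⟨B, hB⟩ := isCompact_Icc.exists_bound_of_continuousOn hy
  refine ⟨_, fun t ht => H.abs_rhs_le (B := B) c ht (le_max_right _ _) ?_⟩
  have := hB t (Ioo_subset_Icc_self ht)
  exact max_le ((le_abs_self _).trans this) ((norm_nonneg _).trans this)

lemma aesm_odeRhs (H : NegativeReaction p p' s M G h f) (c : ℝ) (hy : ContinuousOn y (Icc 0 s)) :
    AEStronglyMeasurable (odeRhs p p' h f c y) (volume.restrict (Ioo 0 s)) := by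
  have hp := H.p_pos
  have h1 : ContinuousOn (fun u => (max (y u) 0) ^ (1 / p)) (Ioo 0 s) :=
    ((hy.mono Ioo_subset_Icc_self).sup continuousOn_const).rpow_const
      fun _ _ => Or.inr (by positivity)
  have h2 : AEStronglyMeasurable (fun u => c - h u) (volume.restrict (Ioo 0 s)) :=
    (measurable_const.sub H.meas).aestronglyMeasurable
  exact ((h2.mul (h1.aestronglyMeasurable measurableSet_Ioo)).sub H.aesm).const_mul p'

lemma intervalIntegrable_odeRhs (H : NegativeReaction p p' s M G h f) (c : ℝ)
    (hy : ContinuousOn y (Icc 0 s)) {a b : ℝ} (ha : a ∈ Icc 0 s) (hb : b ∈ Icc 0 s) :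
    IntervalIntegrable (odeRhs p p' h f c y) volume a b := by
  obtain ⟨L, hL⟩ := H.exists_abs_odeRhs_le c hy
  have h1 : IntegrableOn (odeRhs p p' h f c y) (Ioo 0 s) :=
    Integrable.of_bound (H.aesm_odeRhs c hy) L
      ((ae_restrict_iff' measurableSet_Ioo).2 (Eventually.of_forall hL))
  have h2 : IntegrableOn (odeRhs p p' h f c y) (Icc 0 s) :=
    (integrableOn_Icc_iff_integrableOn_Ioo (by simp) (by simp)).2 h1
  exact (h2.mono_set (uIcc_subset_Icc ha hb)).intervalIntegrable

lemma sub_eq_integral (H : NegativeReaction p p' s M G h f) (hy : IsCaraSol p p' h f c 0 s y)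
    {a b : ℝ} (ha : a ∈ Icc 0 s) (hb : b ∈ Icc 0 s) :
    y b - y a = ∫ u in a..b, odeRhs p p' h f c y u := by
  have h0 : (0 : ℝ) ∈ Icc 0 s := ⟨le_rfl, H.pos.le⟩
  rw [hy.2 a ha, hy.2 b hb, add_sub_add_left_eq_sub]
  exact integral_interval_sub_left (H.intervalIntegrable_odeRhs c hy.1 h0 hb)
    (H.intervalIntegrable_odeRhs c hy.1 h0 ha)

lemma exists_solution (H : NegativeReaction p p' s M G h f) (c : ℝ) :
    ∃ y, IsCaraSol p p' h f c 0 s y ∧ y 0 = 0 := by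
  have hp := H.p_pos
  have hp' := H.conj_pos
  have hM := H.M_nonneg
  have hG := H.G_pos
  have hs := H.pos
  obtain ⟨R, hR0, hR⟩ : ∃ R : ℝ, 0 ≤ R ∧ p' * ((|c| + M) * R ^ (1 / p) + G) * s ≤ R := by
    let B : ℝ := p' * (|c| + M) * s + p' * G * s + 1
    have hB1 : 1 ≤ B := by simp only [B]; linarith [show 0 ≤ p' * (|c| + M) * s by positivity,
      show 0 ≤ p' * G * s by positivity]
    have hB0 : 0 < B := zero_lt_one.trans_le hB1
    have hpp : p' * (1 / p) = p' - 1 := by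
      have := H.one_div_conj
      field_simp at this ⊢
      linarith
    have hp1 : 0 ≤ p' - 1 := by rw [← hpp]; positivity
    refine ⟨B ^ p', by positivity, ?_⟩
    rw [← Real.rpow_mul hB0.le, hpp]
    have h1 : 1 ≤ B ^ (p' - 1) := Real.one_le_rpow hB1 hp1
    have h2 : B ^ p' = B * B ^ (p' - 1) := by
      rw [← Real.rpow_one_add' hB0.le (by linarith)]
      congr 1
      ring
    have h3 : p' * G * s ≤ p' * G * s * B ^ (p' - 1) := le_mul_of_one_le_right (by positivity) h1
    rw [h2]
    simp only [B] at h1 h3 ⊢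
    nlinarith
  let Φ : ℝ → ℝ → ℝ := fun t x =>
    (Ioo 0 s).indicator (fun t => p' * ((c - h t) * (min (max x 0) R) ^ (1 / p) - f t)) t
  let L : ℝ≥0 := ⟨p' * ((|c| + M) * R ^ (1 / p) + G), by positivity⟩
  have hb : ∀ t x, |Φ t x| ≤ L := by
    intro t x
    by_cases ht : t ∈ Ioo 0 s
    · simp only [Φ, indicator_of_mem ht]
      exact H.abs_rhs_le c ht (le_min (le_max_right _ _) hR0) (min_le_right _ _)
    · simp only [Φ, indicator_of_notMem ht, abs_zero]
      exact L.2
  have hc : ∀ t, Continuous (Φ t) := by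
    intro t
    by_cases ht : t ∈ Ioo 0 s
    · simp only [Φ, indicator_of_mem ht]
      have : Continuous fun x : ℝ => (min (max x 0) R) ^ (1 / p) :=
        (by fun_prop : Continuous fun x : ℝ => min (max x 0) R).rpow_const
          fun _ => Or.inr (by positivity)
      fun_prop
    · simp only [Φ, indicator_of_notMem ht]
      exact continuous_const
  have hm : ∀ y : ℝ → ℝ, Continuous y → AEStronglyMeasurable (fun t => Φ t (y t)) volume := by
    intro y hy
    have h1 : Continuous fun t => (min (max (y t) 0) R) ^ (1 / p) :=
      (by fun_prop : Continuous fun t => min (max (y t) 0) R).rpow_const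
        fun _ => Or.inr (by positivity)
    have h2 : AEStronglyMeasurable (fun u => c - h u) (volume.restrict (Ioo 0 s)) :=
      (measurable_const.sub H.meas).aestronglyMeasurable
    exact (aestronglyMeasurable_indicator_iff measurableSet_Ioo).2
      (((h2.mul h1.aestronglyMeasurable).sub H.aesm).const_mul p')
  obtain ⟨y, hyc, hy⟩ := exists_caratheodory_solution hm hc hb H.pos
  have hy0 : y 0 = 0 := by simpa using hy 0 ⟨le_rfl, hs.le⟩
  have hyR : ∀ t ∈ Icc 0 s, y t ≤ R := by
    intro t ht
    rw [hy t ht]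
    have h1 := norm_integral_le_of_norm_le_const (f := fun u => Φ u (y u)) (a := 0) (b := t)
      (C := L) fun u _ => hb u _
    rw [sub_zero, abs_of_nonneg ht.1] at h1
    refine (le_abs_self _).trans (h1.trans (le_trans ?_ hR))
    exact mul_le_mul_of_nonneg_left ht.2 L.2
  refine ⟨y, ⟨hyc.continuousOn, fun t ht => ?_⟩, hy0⟩
  rw [hy0, zero_add, hy t ht]
  refine integral_congr_ae ?_
  have hne : ∀ᵐ u : ℝ, u ≠ s := by simp [ae_iff, measure_singleton]
  filter_upwards [hne] with u hus hu
  rw [uIoc_of_le ht.1] at hu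
  have hmem : u ∈ Ioo 0 s := ⟨hu.1, lt_of_le_of_ne (hu.2.trans ht.2) hus⟩
  simp only [Φ, indicator_of_mem hmem]
  rw [min_eq_left (max_le (hyR u (Ioo_subset_Icc_self hmem)) hR0)]

lemma pos_of_solution (H : NegativeReaction p p' s M G h f) (hy : IsCaraSol p p' h f c 0 s y)
    (hy0 : y 0 = 0) : ∀ t ∈ Ioo 0 s, 0 < y t := by
  have hp := H.p_pos
  have hp' := H.conj_pos
  have hne : 1 / p ≠ 0 := by positivity
  have hnonneg : ∀ t ∈ Icc 0 s, 0 ≤ y t := by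
    intro t ht
    have h1 := le_mul_of_sub_le_of_nonneg (D := fun t => -y t) le_rfl hy.1.neg (by simp [hy0])
      (fun a b ha hab hb hD => ?_) t ht
    · linarith
    have h2 := H.sub_eq_integral hy ⟨ha.le, hab.trans hb.le⟩ ⟨ha.le.trans hab, hb.le⟩
    have h3 : 0 ≤ ∫ u in a..b, odeRhs p p' h f c y u := by
      refine integral_nonneg hab fun u hu => ?_
      have h4 := H.neg u ⟨ha.trans_le hu.1, hu.2.trans_lt hb⟩
      have h5 : max (y u) 0 = 0 := max_eq_right (by linarith [hD u hu])
      rw [odeRhs, h5, Real.zero_rpow hne]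
      nlinarith
    linarith
  intro t ht
  refine (hnonneg t (Ioo_subset_Icc_self ht)).lt_of_ne' fun hyt => ?_
  have hft := H.neg t ht
  have hnhds : Ioo 0 s ∈ 𝓝 t := Ioo_mem_nhds ht.1 ht.2
  have h1 : ∀ᶠ u in 𝓝 t, f u < f t / 2 := by
    have := upperSemicontinuousOn_iff.1 H.usc t ht
    have := upperSemicontinuousWithinAt_iff.1 this (f t / 2) (by linarith)
    rwa [nhdsWithin_eq_nhds.2 hnhds] at this
  have h2 : ∀ᶠ u in 𝓝 t, (|c| + M) * (max (y u) 0) ^ (1 / p) < -(f t / 2) := by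
    have hyc : ContinuousAt y t := hy.1.continuousAt (mem_of_superset hnhds Ioo_subset_Icc_self)
    have h3 : ContinuousAt (fun u => (|c| + M) * (max (y u) 0) ^ (1 / p)) t :=
      ((hyc.sup continuousAt_const).rpow_const (Or.inr (by positivity))).const_mul _
    refine h3.eventually_lt continuousAt_const ?_
    simp only [hyt, max_self, Real.zero_rpow hne]
    linarith
  obtain ⟨a, hat, hau⟩ := (mem_nhdsLE_iff_exists_Ioc_subset' (sub_one_lt t)).1
    (nhdsWithin_le_nhds ((h1.and h2).and hnhds))
  have hab : (a + t) / 2 < t := by linarith [mem_Iio.1 hat]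
  have hmem : ∀ u ∈ Icc ((a + t) / 2) t, u ∈ Ioc a t := fun u hu =>
    ⟨by linarith [mem_Iio.1 hat, hu.1], hu.2⟩
  have ha : (a + t) / 2 ∈ Icc 0 s := Ioo_subset_Icc_self (hau (hmem _ ⟨le_rfl, hab.le⟩)).2
  have h3 := H.sub_eq_integral hy ha (Ioo_subset_Icc_self ht)
  have h4 : 0 < ∫ u in (a + t) / 2..t, odeRhs p p' h f c y u := by
    refine intervalIntegral_pos_of_pos_on
      (H.intervalIntegrable_odeRhs c hy.1 ha (Ioo_subset_Icc_self ht)) (fun u hu => ?_) hab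
    obtain ⟨⟨h5, h6⟩, h7⟩ := hau (hmem u (Ioo_subset_Icc_self hu))
    have h8 : -(|c| + M) ≤ c - h u := by
      linarith [neg_abs_le c, le_abs_self (h u), H.abs_le u (Ioo_subset_Icc_self h7)]
    have h9 := mul_le_mul_of_nonneg_right h8
      (Real.rpow_nonneg (le_max_right (y u) 0) (1 / p))
    exact mul_pos hp' (by linarith)
  linarith [hnonneg _ ha]

/-- The power `y ^ (1 / p')` of a solution satisfies an equation decreasing in the unknown. -/
lemma transformed_integral (H : NegativeReaction p p' s M G h f) (hy : IsCaraSol p p' h f c 0 s y)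
    (hy0 : y 0 = 0) {a b : ℝ} (ha : 0 < a) (hab : a ≤ b) (hb : b < s) :
    IntervalIntegrable (fun u => c - h u - f u * y u ^ (-(1 / p))) volume a b ∧
    y b ^ (1 / p') - y a ^ (1 / p') = ∫ u in a..b, (c - h u - f u * y u ^ (-(1 / p))) := by
  have hp' := H.conj_pos
  have hpos := H.pos_of_solution hy hy0
  have hsub : Icc a b ⊆ Ioo 0 s := fun t ht => ⟨ha.trans_le ht.1, ht.2.trans_lt hb⟩
  have hsub' : Icc a b ⊆ Icc 0 s := hsub.trans Ioo_subset_Icc_self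
  have hamem : a ∈ Icc a b := left_mem_Icc.2 hab
  obtain ⟨L, hL⟩ := H.exists_abs_odeRhs_le c hy.1
  have hint := H.intervalIntegrable_odeRhs c hy.1 (hsub' hamem) (hsub' (right_mem_Icc.2 hab))
  have hr : 1 / p' - 1 = -(1 / p) := by rw [H.one_div_conj]; ring
  have heq : ∀ u ∈ Icc a b, 1 / p' * y u ^ (1 / p' - 1) * odeRhs p p' h f c y u =
      c - h u - f u * y u ^ (-(1 / p)) := by
    intro u hu
    have hyu := hpos u (hsub hu)
    have h1 : y u ^ (-(1 / p)) * y u ^ (1 / p) = 1 := by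
      rw [← Real.rpow_add hyu, neg_add_cancel, Real.rpow_zero]
    rw [hr, odeRhs, max_eq_left hyu.le]
    field_simp
    linear_combination (c - h u) * h1
  have hcont : ContinuousOn (fun u => 1 / p' * y u ^ (1 / p' - 1)) (uIcc a b) := by
    rw [uIcc_of_le hab]
    exact ((hy.1.mono hsub').rpow_const fun u hu => Or.inl (hpos u (hsub hu)).ne').const_mul _
  constructor
  · refine (hint.continuousOn_mul hcont).congr fun u hu => ?_
    rw [uIoc_of_le hab] at hu
    exact heq u (Ioc_subset_Icc_self hu)
  · rw [rpow_sub_rpow_eq_integral hab hint (fun t ht => hL t (hsub ht))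
      (fun t ht => by
        rw [← sub_eq_iff_eq_add']
        exact H.sub_eq_integral hy (hsub' hamem) (hsub' ht))
      (fun t ht => hpos t (hsub ht)) (1 / p')]
    refine integral_congr fun u hu => ?_
    rw [uIcc_of_le hab] at hu
    exact heq u hu

lemma continuousOn_rpow (H : NegativeReaction p p' s M G h f) (hy : ContinuousOn y (Icc 0 s)) :
    ContinuousOn (fun t => y t ^ (1 / p')) (Icc 0 s) :=
  hy.rpow_const fun _ _ => Or.inr (one_div_pos.2 H.conj_pos).le

lemma zero_rpow_conj (H : NegativeReaction p p' s M G h f) : (0 : ℝ) ^ (1 / p') = 0 :=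
  Real.zero_rpow (one_div_pos.2 H.conj_pos).ne'

lemma nonneg_of_solution (H : NegativeReaction p p' s M G h f) (hy : IsCaraSol p p' h f c 0 s y)
    (hy0 : y 0 = 0) : ∀ t ∈ Icc 0 s, 0 ≤ y t := by
  intro t ht
  have hcl : closure (Ioo 0 s) = Icc 0 s := closure_Ioo H.pos.ne
  have hyc := hy.1
  rw [← hcl] at ht hyc
  exact le_on_closure (fun t ht => (H.pos_of_solution hy hy0 t ht).le) continuousOn_const hyc ht

lemma rpow_sub_le (H : NegativeReaction p p' s M G h f) {c₁ c₂ κ : ℝ} {y₁ y₂ : ℝ → ℝ}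
    (h₁ : IsCaraSol p p' h f c₁ 0 s y₁) (h₁0 : y₁ 0 = 0)
    (h₂ : IsCaraSol p p' h f c₂ 0 s y₂) (h₂0 : y₂ 0 = 0) (hκ : 0 ≤ κ) (hc : c₁ - c₂ ≤ κ) :
    ∀ t ∈ Icc 0 s, y₁ t ^ (1 / p') - y₂ t ^ (1 / p') ≤ κ * t := by
  have hp := H.p_pos
  have hp' := H.conj_pos
  refine le_mul_of_sub_le_of_nonneg hκ ((H.continuousOn_rpow h₁.1).sub (H.continuousOn_rpow h₂.1))
    (by rw [h₁0, h₂0, sub_self]) fun a b ha hab hb hD => ?_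
  obtain ⟨i₁, e₁⟩ := H.transformed_integral h₁ h₁0 ha hab hb
  obtain ⟨i₂, e₂⟩ := H.transformed_integral h₂ h₂0 ha hab hb
  have hle : ∫ u in a..b, (c₁ - h u - f u * y₁ u ^ (-(1 / p))) ≤
      ∫ u in a..b, (κ + (c₂ - h u - f u * y₂ u ^ (-(1 / p)))) := by
    refine integral_mono_on hab i₁ (intervalIntegrable_const.add i₂) fun u hu => ?_
    have hu' : u ∈ Ioo 0 s := ⟨ha.trans_le hu.1, hu.2.trans_lt hb⟩
    have hp1 := H.pos_of_solution h₁ h₁0 u hu'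
    have hp2 := H.pos_of_solution h₂ h₂0 u hu'
    have hle : y₂ u ≤ y₁ u :=
      (Real.rpow_le_rpow_iff hp2.le hp1.le (one_div_pos.2 hp')).1 (sub_nonneg.1 (hD u hu))
    have hle' : y₁ u ^ (-(1 / p)) ≤ y₂ u ^ (-(1 / p)) :=
      Real.rpow_le_rpow_of_nonpos hp2 hle (by rw [neg_nonpos]; positivity)
    nlinarith [H.neg u hu']
  rw [integral_add intervalIntegrable_const i₂, intervalIntegral.integral_const, smul_eq_mul] at hle
  linarith

lemma eqOn_of_solution (H : NegativeReaction p p' s M G h f) {y₁ y₂ : ℝ → ℝ}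
    (h₁ : IsCaraSol p p' h f c 0 s y₁) (h₁0 : y₁ 0 = 0)
    (h₂ : IsCaraSol p p' h f c 0 s y₂) (h₂0 : y₂ 0 = 0) : EqOn y₁ y₂ (Icc 0 s) := by
  intro t ht
  have e1 := H.rpow_sub_le h₁ h₁0 h₂ h₂0 le_rfl (sub_self c).le t ht
  have e2 := H.rpow_sub_le h₂ h₂0 h₁ h₁0 le_rfl (sub_self c).le t ht
  exact (Real.rpow_left_inj (H.nonneg_of_solution h₁ h₁0 t ht) (H.nonneg_of_solution h₂ h₂0 t ht)
    (one_div_pos.2 H.conj_pos).ne').1 (by linarith)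

lemma rpow_le_of_barrier (H : NegativeReaction p p' s M G h f) (hy : IsCaraSol p p' h f c 0 s y)
    (hy0 : y 0 = 0) {β : ℝ} (hβ : 0 < β)
    (hbar : ∀ t ∈ Ioo 0 s, c - h t - f t * (β * (s - t)) ^ (-(p' - 1)) ≤ -β) :
    ∀ t ∈ Icc 0 s, y t ^ (1 / p') ≤ β * (s - t) := by
  have hp := H.p_pos
  have hp' := H.conj_pos
  have hexp : 1 / p' * -(p' - 1) = -(1 / p) := by
    have := H.one_div_conj
    field_simp at this ⊢
    linarith
  intro t ht
  have key := le_mul_of_sub_le_of_nonneg (D := fun t => y t ^ (1 / p') - β * (s - t)) le_rfl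
    ((H.continuousOn_rpow hy.1).sub (by fun_prop))
    (by simp only [hy0, H.zero_rpow_conj]; nlinarith [H.pos]) (fun a b ha hab hb hD => ?_) t ht
  · linarith
  obtain ⟨i, e⟩ := H.transformed_integral hy hy0 ha hab hb
  have hle : ∫ u in a..b, (c - h u - f u * y u ^ (-(1 / p))) ≤ ∫ u in a..b, -β := by
    refine integral_mono_on hab i intervalIntegrable_const fun u hu => ?_
    have hu' : u ∈ Ioo 0 s := ⟨ha.trans_le hu.1, hu.2.trans_lt hb⟩
    have hyu := H.pos_of_solution hy hy0 u hu'
    have hp1 : 1 ≤ p' := by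
      rw [H.conj, one_le_div (sub_pos.2 H.one_lt)]
      linarith
    have hle' : y u ^ (-(1 / p)) ≤ (β * (s - u)) ^ (-(p' - 1)) := by
      rw [← hexp, Real.rpow_mul hyu.le]
      exact Real.rpow_le_rpow_of_nonpos (mul_pos hβ (sub_pos.2 hu'.2)) (sub_nonneg.1 (hD u hu))
        (by linarith)
    nlinarith [H.neg u hu', hbar u hu']
  rw [intervalIntegral.integral_const, smul_eq_mul] at hle
  linarith

lemma lt_mean_of_eq_zero (H : NegativeReaction p p' s M G h f) (hy : IsCaraSol p p' h f c 0 s y)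
    (hy0 : y 0 = 0) (hys : y s = 0) : c < (∫ t in (0 : ℝ)..s, h t) / s := by
  have hs := H.pos
  have hint : ∀ a ∈ Icc 0 s, ∀ b ∈ Icc 0 s, IntervalIntegrable (fun u => c - h u) volume a b := by
    intro a ha b hb
    have h1 : IntegrableOn (fun u => c - h u) (Icc 0 s) :=
      Integrable.of_bound (measurable_const.sub H.meas).aestronglyMeasurable (|c| + M)
        ((ae_restrict_iff' measurableSet_Icc).2 (Eventually.of_forall fun u hu =>
          (abs_sub _ _).trans (add_le_add le_rfl (H.abs_le u hu))))
    exact (h1.mono_set (uIcc_subset_Icc ha hb)).intervalIntegrable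
  have hinth : IntervalIntegrable h volume 0 s := by
    simpa using (intervalIntegrable_const (c := c)).sub
      (hint 0 ⟨le_rfl, hs.le⟩ s ⟨hs.le, le_rfl⟩)
  have h0mem : (0 : ℝ) ∈ Icc 0 s := ⟨le_rfl, hs.le⟩
  have hsmem : s ∈ Icc 0 s := ⟨hs.le, le_rfl⟩
  let E : ℝ → ℝ := fun t => y t ^ (1 / p') - ∫ u in (0 : ℝ)..t, (c - h u)
  have hE : ContinuousOn E (Icc 0 s) := by
    refine (H.continuousOn_rpow hy.1).sub ?_
    have := continuousOn_primitive_interval' (hint 0 h0mem s hsmem) (left_mem_uIcc)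
    rwa [uIcc_of_le hs.le] at this
  have hdiff : ∀ a b, 0 < a → a ≤ b → b < s → E b - E a =
      ∫ u in a..b, -f u * y u ^ (-(1 / p)) ∧
      IntervalIntegrable (fun u => -f u * y u ^ (-(1 / p))) volume a b := by
    intro a b ha hab hb
    have ham : a ∈ Icc 0 s := ⟨ha.le, hab.trans hb.le⟩
    have hbm : b ∈ Icc 0 s := ⟨ha.le.trans hab, hb.le⟩
    obtain ⟨i, e⟩ := H.transformed_integral hy hy0 ha hab hb
    have i' : IntervalIntegrable (fun u => -f u * y u ^ (-(1 / p))) volume a b := by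
      refine (i.sub (hint a ham b hbm)).congr fun u _ => ?_
      ring
    refine ⟨?_, i'⟩
    have h1 : E b - E a = (y b ^ (1 / p') - y a ^ (1 / p')) -
        ((∫ u in (0 : ℝ)..b, (c - h u)) - ∫ u in (0 : ℝ)..a, (c - h u)) := by
      simp only [E]
      ring
    rw [h1, e, integral_interval_sub_left (hint 0 h0mem b hbm) (hint 0 h0mem a ham),
      ← integral_sub i (hint a ham b hbm)]
    refine integral_congr fun u _ => ?_
    ring
  have hpos : ∀ u ∈ Ioo 0 s, 0 < -f u * y u ^ (-(1 / p)) := fun u hu =>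
    mul_pos (neg_pos.2 (H.neg u hu)) (Real.rpow_pos_of_pos (H.pos_of_solution hy hy0 u hu) _)
  have hmono : ∀ a b, 0 < a → a ≤ b → b < s → E a ≤ E b := by
    intro a b ha hab hb
    rw [← sub_nonneg, (hdiff a b ha hab hb).1]
    exact integral_nonneg hab fun u hu => (hpos u ⟨ha.trans_le hu.1, hu.2.trans_lt hb⟩).le
  have hstrict : E (s / 3) < E (s / 2) := by
    obtain ⟨e, i⟩ := hdiff (s / 3) (s / 2) (by positivity) (by linarith) (by linarith)
    rw [← sub_pos, e]
    exact intervalIntegral_pos_of_pos_on i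
      (fun u hu => hpos u ⟨by linarith [hu.1], by linarith [hu.2]⟩) (by linarith)
  have hleft : E 0 ≤ E (s / 3) := by
    have hcl : closure (Ioo 0 (s / 3)) = Icc 0 (s / 3) := closure_Ioo (by positivity)
    refine le_on_closure (s := Ioo 0 (s / 3)) (f := E) (g := fun _ => E (s / 3))
      (fun t ht => hmono t _ ht.1 ht.2.le (by linarith)) ?_ continuousOn_const ?_
    · rw [hcl]
      exact hE.mono (Icc_subset_Icc_right (by linarith))
    · rw [hcl]
      exact ⟨le_rfl, by positivity⟩
  have hright : E (s / 2) ≤ E s := by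
    have hcl : closure (Ioo (s / 2) s) = Icc (s / 2) s := closure_Ioo (by linarith)
    refine le_on_closure (s := Ioo (s / 2) s) (g := E) (f := fun _ => E (s / 2))
      (fun t ht => hmono _ t (by linarith) ht.1.le ht.2) continuousOn_const ?_ ?_
    · rw [hcl]
      exact hE.mono (Icc_subset_Icc_left (by linarith))
    · rw [hcl]
      exact ⟨by linarith, le_rfl⟩
  have hE0 : E 0 = 0 := by simp only [E, hy0, H.zero_rpow_conj, integral_same, sub_zero]
  have hEs : E s = (∫ t in (0 : ℝ)..s, h t) - c * s := by
    simp only [E, hys, H.zero_rpow_conj]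
    rw [integral_sub intervalIntegrable_const hinth, intervalIntegral.integral_const, smul_eq_mul]
    ring
  rw [lt_div_iff₀ hs]
  linarith

lemma le_apply_of_eq_zero (H : NegativeReaction p p' s M G h f) (hh : ContinuousAt h s)
    (hy : IsCaraSol p p' h f c 0 s y) (hy0 : y 0 = 0) (hys : y s = 0) : c ≤ h s := by
  by_contra! hlt
  have hs := H.pos
  have hp' := H.conj_pos
  have hev : ∀ᶠ u in 𝓝 s, h u < c ∧ 0 < u :=
    (hh.eventually_lt continuousAt_const hlt).and (lt_mem_nhds hs)
  obtain ⟨a, has, hau⟩ := (mem_nhdsLE_iff_exists_Ioc_subset' (sub_one_lt s)).1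
    (nhdsWithin_le_nhds hev)
  let a' := (max a 0 + s) / 2
  have hmax : max a 0 < s := max_lt has hs
  have ha's : a' < s := by simp only [a']; linarith
  have ha'a : a < a' := by simp only [a']; linarith [le_max_left a 0]
  have ha'0 : 0 < a' := by simp only [a']; linarith [le_max_right a 0]
  have hle : ∀ b ∈ Ioo a' s, y a' ^ (1 / p') ≤ y b ^ (1 / p') := by
    intro b hb
    obtain ⟨-, e⟩ := H.transformed_integral hy hy0 ha'0 hb.1.le hb.2
    rw [← sub_nonneg, e]
    refine integral_nonneg hb.1.le fun u hu => ?_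
    have hu' : u ∈ Ioo 0 s := ⟨ha'0.trans_le hu.1, hu.2.trans_lt hb.2⟩
    have h1 := (hau (show u ∈ Ioc a s from ⟨ha'a.trans_le hu.1, hu'.2.le⟩)).1
    have h2 := mul_pos (neg_pos.2 (H.neg u hu'))
      (Real.rpow_pos_of_pos (H.pos_of_solution hy hy0 u hu') (-(1 / p)))
    linarith
  have hcl : closure (Ioo a' s) = Icc a' s := closure_Ioo ha's.ne
  have h1 : y a' ^ (1 / p') ≤ y s ^ (1 / p') := by
    refine le_on_closure (s := Ioo a' s) (f := fun _ => y a' ^ (1 / p'))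
      (g := fun t => y t ^ (1 / p')) hle continuousOn_const ?_ ?_
    · rw [hcl]
      exact (H.continuousOn_rpow hy.1).mono (Icc_subset_Icc_left ha'0.le)
    · rw [hcl]
      exact ⟨ha's.le, le_rfl⟩
  rw [hys, H.zero_rpow_conj] at h1
  exact absurd (Real.rpow_pos_of_pos (H.pos_of_solution hy hy0 a' ⟨ha'0, ha's⟩) _) (not_lt.2 h1)

lemma exists_isPosBVPSol_iff (H : NegativeReaction p p' s M G h f)
    (hy : IsCaraSol p p' h f c 0 s y) (hy0 : y 0 = 0) :
    (∃ w, IsPosBVPSol p p' h f c 0 s w) ↔ y s = 0 := by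
  constructor
  · rintro ⟨w, hw, hw0, hws, -⟩
    rw [H.eqOn_of_solution hy hy0 hw hw0 ⟨H.pos.le, le_rfl⟩, hws]
  · exact fun hys => ⟨y, hy, hy0, hys, H.pos_of_solution hy hy0⟩

/-- The set of speeds for which the boundary value problem is solvable is a closed half-line. -/
lemma exists_threshold (H : NegativeReaction p p' s M G h f) {c₀ : ℝ}
    (hc₀ : ∃ w, IsPosBVPSol p p' h f c₀ 0 s w) :
    ∃ cF, c₀ ≤ cF ∧ ∀ c, (∃ w, IsPosBVPSol p p' h f c 0 s w) ↔ c ≤ cF := by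
  choose Y hY hY0 using H.exists_solution
  have hiff : ∀ c, (∃ w, IsPosBVPSol p p' h f c 0 s w) ↔ Y c s = 0 := fun c =>
    H.exists_isPosBVPSol_iff (hY c) (hY0 c)
  have hsmem : s ∈ Icc 0 s := ⟨H.pos.le, le_rfl⟩
  have hnonneg : ∀ c, 0 ≤ Y c s := fun c => H.nonneg_of_solution (hY c) (hY0 c) s hsmem
  have hzero : ∀ c, (∀ ε > 0, Y c s ^ (1 / p') ≤ ε) → Y c s = 0 := by
    intro c hc
    have h1 : Y c s ^ (1 / p') ≤ 0 := le_of_forall_pos_le_add fun ε hε => by simpa using hc ε hε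
    exact (hnonneg c).antisymm' (not_lt.1 fun hlt => absurd (Real.rpow_pos_of_pos hlt _) (not_lt.2 h1))
  let A : Set ℝ := {c | Y c s = 0}
  have hne : A.Nonempty := ⟨c₀, (hiff c₀).1 hc₀⟩
  have hbdd : BddAbove A := ⟨_, fun c hc => (H.lt_mean_of_eq_zero (hY c) (hY0 c) hc).le⟩
  refine ⟨sSup A, le_csSup hbdd ((hiff c₀).1 hc₀), fun c => (hiff c).trans
    ⟨fun hc => le_csSup hbdd hc, fun hc => hzero c fun ε hε => ?_⟩⟩
  obtain ⟨d, hd, hdlt⟩ := exists_lt_of_lt_csSup hne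
    (sub_lt_self (sSup A) (div_pos hε H.pos))
  have hκ : c - d ≤ ε / s := by linarith
  have h1 := H.rpow_sub_le (hY c) (hY0 c) (hY d) (hY0 d) (div_pos hε H.pos).le hκ s hsmem
  rwa [show Y d s = 0 from hd, H.zero_rpow_conj, sub_zero, div_mul_cancel₀ _ H.pos.ne'] at h1

/-- Solvability below the explicit linear barrier. -/
lemma exists_isPosBVPSol_of_le (H : NegativeReaction p p' s M G h f) {m μ : ℝ} (hμ : 0 < μ)
    (hm : ∀ t ∈ Ioo 0 s, m ≤ h t) (hfμ : ∀ t ∈ Ioo 0 s, -f t ≤ μ * (s - t) ^ (p' - 1))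
    (hc : c ≤ m - p' ^ (1 / p') * p ^ (1 / p) * μ ^ (1 / p')) :
    ∃ w, IsPosBVPSol p p' h f c 0 s w := by
  obtain ⟨y, hy, hy0⟩ := H.exists_solution c
  rw [H.exists_isPosBVPSol_iff hy hy0]
  have hp := H.p_pos
  have hp1 : 0 < p - 1 := sub_pos.2 H.one_lt
  have hp' := H.conj_pos
  have hconj : p' - 1 = 1 / (p - 1) := by
    rw [H.conj]
    field_simp
    ring
  let β : ℝ := (μ / (p - 1)) ^ (1 / p')
  have hβ : 0 < β := by positivity
  have hβp : β ^ p' = μ / (p - 1) := by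
    simp only [β]
    rw [← Real.rpow_mul (by positivity), one_div_mul_cancel hp'.ne', Real.rpow_one]
  have hβμ : μ * β ^ (-(p' - 1)) = β * (p - 1) := by
    rw [neg_sub, Real.rpow_sub hβ, Real.rpow_one, hβp]
    field_simp
  have hconst : p' ^ (1 / p') * p ^ (1 / p) * μ ^ (1 / p') = β * p := by
    have h1 : p' ^ (1 / p') = p ^ (1 / p') / (p - 1) ^ (1 / p') := by
      rw [← Real.div_rpow hp.le hp1.le, ← H.conj]
    have h2 : p ^ (1 / p') * p ^ (1 / p) = p := by
      rw [← Real.rpow_add hp, H.one_div_conj, sub_add_cancel, Real.rpow_one]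
    simp only [β]
    rw [h1, Real.div_rpow hμ.le hp1.le]
    linear_combination (μ ^ (1 / p') / (p - 1) ^ (1 / p')) * h2
  have hbar : ∀ t ∈ Ioo 0 s, c - h t - f t * (β * (s - t)) ^ (-(p' - 1)) ≤ -β := by
    intro t ht
    have hst : 0 < s - t := sub_pos.2 ht.2
    have h1 : -f t * (β * (s - t)) ^ (-(p' - 1)) ≤ β * (p - 1) := by
      have h2 := mul_le_mul_of_nonneg_right (hfμ t ht)
        (Real.rpow_nonneg (mul_pos hβ hst).le (-(p' - 1)))
      refine h2.trans_eq ?_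
      rw [Real.mul_rpow hβ.le hst.le, ← hβμ]
      have h3 : (s - t) ^ (p' - 1) * (s - t) ^ (-(p' - 1)) = 1 := by
        rw [← Real.rpow_add hst, add_neg_cancel, Real.rpow_zero]
      linear_combination (μ * β ^ (-(p' - 1))) * h3
    linarith [hm t ht]
  have hle := H.rpow_le_of_barrier hy hy0 hβ hbar s ⟨H.pos.le, le_rfl⟩
  rw [sub_self, mul_zero] at hle
  have hnn := H.nonneg_of_solution hy hy0 s ⟨H.pos.le, le_rfl⟩
  exact hnn.antisymm' (not_lt.1 fun hlt => absurd (Real.rpow_pos_of_pos hlt _) (not_lt.2 hle))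

end NegativeReaction

theorem stmt_9
    (p p' s : ℝ) (h f : ℝ → ℝ)
    (hp : 1 < p) (hp'def : p' = p / (p - 1))
    (hs : s ∈ Set.Ioo (0:ℝ) 1)
    (hmeas : Measurable h)
    (hbd : ∃ M : ℝ, ∀ t ∈ Set.Icc (0:ℝ) 1, |h t| ≤ M)
    (hfint : MeasureTheory.IntegrableOn f (Set.Ioo (0:ℝ) 1))
    (hf0 : f 0 = 0) (hfs : f s = 0) (hf1 : f 1 = 0)
    (hfneg : ∀ t ∈ Set.Ioo (0:ℝ) s, f t < 0)
    (hfpos : ∀ t ∈ Set.Ioo s (1:ℝ), 0 < f t)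
    (husc : UpperSemicontinuousOn f (Set.Ioo (0:ℝ) s))
    (hlsc : LowerSemicontinuousOn f (Set.Ioo s (1:ℝ)))
    (hhc : ContinuousAt h s)
    (hhfin : ∃ S : Finset ℝ, ContinuousOn h (Set.Icc (0:ℝ) 1 \ ↑S))
    (hbddA : BddAbove {x : ℝ | ∃ t ∈ Set.Ioo (0:ℝ) s, x = -f t / (s - t) ^ (p' - 1)})
    (hposA : 0 < sSup {x : ℝ | ∃ t ∈ Set.Ioo (0:ℝ) s, x = -f t / (s - t) ^ (p' - 1)}) :
    (h s < (∫ t in (0:ℝ)..s, h t) / s →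
      ∃ cF ∈ Set.Icc
          (sInf (h '' Set.Icc (0:ℝ) s) -
            p' ^ (1 / p') * p ^ (1 / p) *
              (sSup {x : ℝ | ∃ t ∈ Set.Ioo (0:ℝ) s, x = -f t / (s - t) ^ (p' - 1)}) ^ (1 / p'))
          (h s),
        (∀ c : ℝ, (∃ y, IsPosBVPSol p p' h f c 0 s y) ↔ c ≤ cF) ∧
        (∀ c : ℝ, ∀ y₁ y₂, IsPosBVPSol p p' h f c 0 s y₁ → IsPosBVPSol p p' h f c 0 s y₂ →
          Set.EqOn y₁ y₂ (Set.Icc 0 s))) ∧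
    ((∫ t in (0:ℝ)..s, h t) / s ≤ h s →
      ∃ cF ∈ Set.Ico
          (sInf (h '' Set.Icc (0:ℝ) s) -
            p' ^ (1 / p') * p ^ (1 / p) *
              (sSup {x : ℝ | ∃ t ∈ Set.Ioo (0:ℝ) s, x = -f t / (s - t) ^ (p' - 1)}) ^ (1 / p'))
          ((∫ t in (0:ℝ)..s, h t) / s),
        (∀ c : ℝ, (∃ y, IsPosBVPSol p p' h f c 0 s y) ↔ c ≤ cF) ∧
        (∀ c : ℝ, ∀ y₁ y₂, IsPosBVPSol p p' h f c 0 s y₁ → IsPosBVPSol p p' h f c 0 s y₂ →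
          Set.EqOn y₁ y₂ (Set.Icc 0 s))) := by
  obtain ⟨M, hM⟩ := hbd
  have hp1 : 0 ≤ p' - 1 := by
    rw [hp'def, sub_nonneg, one_le_div (sub_pos.2 hp)]
    linarith
  set μ := sSup {x : ℝ | ∃ t ∈ Ioo (0 : ℝ) s, x = -f t / (s - t) ^ (p' - 1)} with hμ
  have hfμ : ∀ t ∈ Ioo 0 s, -f t ≤ μ * (s - t) ^ (p' - 1) := fun t ht =>
    (div_le_iff₀ (Real.rpow_pos_of_pos (sub_pos.2 ht.2) _)).1 (le_csSup hbddA ⟨t, ht, rfl⟩)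
  have H : NegativeReaction p p' s M (μ * s ^ (p' - 1)) h f :=
    { one_lt := hp
      conj := hp'def
      pos := hs.1
      meas := hmeas
      abs_le := fun t ht => hM t ⟨ht.1, ht.2.trans hs.2.le⟩
      aesm := (hfint.mono_set (Ioo_subset_Ioo_right hs.2.le)).aestronglyMeasurable
      neg := hfneg
      neg_le := fun t ht => (hfμ t ht).trans (mul_le_mul_of_nonneg_left
        (Real.rpow_le_rpow (sub_pos.2 ht.2).le (by linarith [ht.1]) hp1) hposA.le)
      usc := husc }
  have hbelow : BddBelow (h '' Icc 0 s) := by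
    refine ⟨-M, ?_⟩
    rintro _ ⟨t, ht, rfl⟩
    exact (abs_le.1 (H.abs_le t ht)).1
  obtain ⟨cF, hcF, hiff⟩ := H.exists_threshold (H.exists_isPosBVPSol_of_le hposA
    (fun t ht => csInf_le hbelow (mem_image_of_mem h (Ioo_subset_Icc_self ht))) hfμ le_rfl)
  have huniq : ∀ c : ℝ, ∀ y₁ y₂, IsPosBVPSol p p' h f c 0 s y₁ → IsPosBVPSol p p' h f c 0 s y₂ →
      EqOn y₁ y₂ (Icc 0 s) := fun c y₁ y₂ h₁ h₂ => H.eqOn_of_solution h₁.1 h₁.2.1 h₂.1 h₂.2.1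
  obtain ⟨y, hy, hy0, hys, -⟩ := (hiff cF).2 le_rfl
  exact ⟨fun _ => ⟨cF, ⟨hcF, H.le_apply_of_eq_zero hhc hy hy0 hys⟩, hiff, huniq⟩,
    fun _ => ⟨cF, ⟨hcF, H.lt_mean_of_eq_zero hy hy0 hys⟩, hiff, huniq⟩⟩
end
end

section
/- Assume (H3) and ν̃ > 0, where ν̃ = liminf_{t → s_*⁻} (−f(t))/(s_* − t)^{p'−1} ∈ (0, ∞]. If c ∈ ℝ satisfies h(s_*) − (p')^{1/p'} p^{1/p} ν̃^{1/p'} < c < h(s_*) (the left-hand bound being interpreted as −∞ when ν̃ = ∞), then the boundary value problem on [0, s_*] admits no positive solution. In particular, if ν̃ = ∞, then there is no positive solution for any c < h(s_*). -/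
open MeasureTheory Set Filter Topology intervalIntegral

noncomputable section

/-- Young's inequality in strict form: `k x^(1/p) < x + ν` for `k` below the sharp constant. -/
lemma mul_rpow_lt_add_of_lt {p p' k ν x : ℝ} (hpq : p.HolderConjugate p') (hν : 0 < ν) (hx : 0 < x)
    (hk : k < p' ^ (1 / p') * p ^ (1 / p) * ν ^ (1 / p')) :
    k * x ^ (1 / p) < x + ν := by
  have hp := hpq.pos
  have hp' := hpq.symm.pos
  have hsum : 1 / p + 1 / p' = 1 := by simpa using hpq.inv_add_inv_eq_one
  have h := Real.geom_mean_le_arith_mean2_weighted (w₁ := 1 / p) (w₂ := 1 / p') (p₁ := p * x)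
    (p₂ := p' * ν) (by positivity) (by positivity) (by positivity) (by positivity) hsum
  rw [Real.mul_rpow hp.le hx.le, Real.mul_rpow hp'.le hν.le] at h
  have e : 1 / p * (p * x) + 1 / p' * (p' * ν) = x + ν := by field_simp
  rw [e] at h
  have hx' : 0 < x ^ (1 / p) := by positivity
  nlinarith [mul_lt_mul_of_pos_right hk hx']

lemma integral_mul_sub_rpow {q s t : ℝ} (hq : 0 < q) :
    ∫ u in t..s, q * (s - u) ^ (q - 1) = (s - t) ^ q := by
  rw [intervalIntegral.integral_const_mul,
    intervalIntegral.integral_comp_sub_left (fun u => u ^ (q - 1)) s,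
    integral_rpow (Or.inl (by linarith))]
  simp only [sub_self, sub_add_cancel, Real.zero_rpow hq.ne', sub_zero]
  field_simp

lemma le_rpow_of_le_mul_rpow {p p' m r : ℝ} (hpq : p.HolderConjugate p') (hm : 0 < m)
    (h : m ≤ r * m ^ (1 / p)) : m ≤ r ^ p' := by
  have hp' := hpq.symm.pos
  have hsum : 1 / p + 1 / p' = 1 := by simpa using hpq.inv_add_inv_eq_one
  have e : m = m ^ (1 / p') * m ^ (1 / p) := by
    rw [← Real.rpow_add hm, add_comm, hsum, Real.rpow_one]
  have h1 : m ^ (1 / p') ≤ r :=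
    le_of_mul_le_mul_right (e.symm.trans_le h) (by positivity)
  calc m = (m ^ (1 / p')) ^ p' := by
        rw [← Real.rpow_mul hm.le, one_div_mul_cancel hp'.ne', Real.rpow_one]
    _ ≤ r ^ p' := Real.rpow_le_rpow (by positivity) h1 hp'.le

/-- A continuous function that is positive on `[a,s)` cannot be dominated by the integral operator
`y ↦ ∫ p' (k y^(1/p) - ν (s - u)^(p'-1))` when `k` is below the sharp constant. -/
lemma not_forall_le_integral {p p' k ν a s : ℝ} {y : ℝ → ℝ} (hpq : p.HolderConjugate p')
    (hν : 0 < ν) (hk0 : 0 < k) (hk : k < p' ^ (1 / p') * p ^ (1 / p) * ν ^ (1 / p'))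
    (has : a < s) (hy : ContinuousOn y (Icc a s)) (hpos : ∀ t ∈ Ico a s, 0 < y t) (hys : y s = 0) :
    ¬ ∀ t ∈ Icc a s, y t ≤ ∫ u in t..s, p' * (k * y u ^ (1 / p) - ν * (s - u) ^ (p' - 1)) := by
  intro hle
  have hp := hpq.pos
  have hp' := hpq.symm.pos
  have hq : 0 < p' - 1 := by linarith [hpq.symm.lt]
  have hnn : ∀ t ∈ Icc a s, 0 ≤ y t := fun t ht => by
    rcases ht.2.eq_or_lt with h | h
    · rw [h, hys]
    · exact (hpos t ⟨ht.1, h⟩).le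
  have hint : ∀ t ∈ Icc a s, IntervalIntegrable
      (fun u => p' * (k * y u ^ (1 / p) - ν * (s - u) ^ (p' - 1))) volume t s := fun t ht => by
    refine ContinuousOn.intervalIntegrable ?_
    rw [uIcc_of_le ht.2]
    have hy' := hy.mono (Icc_subset_Icc_left ht.1)
    have h1 : ContinuousOn (fun u => y u ^ (1 / p)) (Icc t s) :=
      hy'.rpow_const fun _ _ => Or.inr (by positivity)
    have h2 : ContinuousOn (fun u => (s - u) ^ (p' - 1)) (Icc t s) :=
      (by fun_prop : ContinuousOn (fun u => s - u) (Icc t s)).rpow_const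
        fun _ _ => Or.inr hq.le
    fun_prop
  have hbound : ∀ t ∈ Ico a s, y t / (s - t) ^ p' ≤ (p' * k) ^ p' := by
    intro t ht
    have hst : 0 < s - t := sub_pos.2 ht.2
    obtain ⟨v, hv, hmax⟩ := isCompact_Icc.exists_isMaxOn (nonempty_Icc.2 ht.2.le)
      (hy.mono (Icc_subset_Icc_left ht.1))
    have hva : v ∈ Icc a s := ⟨ht.1.trans hv.1, hv.2⟩
    have hyv : y t ≤ y v := hmax ⟨le_rfl, ht.2.le⟩
    have hyv0 : 0 < y v := (hpos t ht).trans_le hyv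
    have h1 : y v ≤ ∫ _ in v..s, p' * (k * y v ^ (1 / p)) := by
      refine (hle v hva).trans (intervalIntegral.integral_mono_on hv.2 (hint v hva)
        intervalIntegrable_const fun u hu => ?_)
      have h2 : y u ^ (1 / p) ≤ y v ^ (1 / p) :=
        Real.rpow_le_rpow (hnn u ⟨hva.1.trans hu.1, hu.2⟩) (hmax ⟨hv.1.trans hu.1, hu.2⟩)
          (by positivity)
      have h3 : 0 ≤ (s - u) ^ (p' - 1) := Real.rpow_nonneg (sub_nonneg.2 hu.2) _
      gcongr
      nlinarith [mul_le_mul_of_nonneg_left h2 hk0.le, mul_nonneg hν.le h3]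
    rw [intervalIntegral.integral_const, smul_eq_mul] at h1
    have h4 : y v ≤ (p' * k * (s - t)) * y v ^ (1 / p) := by
      refine h1.trans ?_
      rw [show p' * k * (s - t) * y v ^ (1 / p) = (s - t) * (p' * (k * y v ^ (1 / p))) by ring]
      gcongr
      exact hv.1
    rw [div_le_iff₀ (by positivity), ← Real.mul_rpow (by positivity) hst.le]
    exact hyv.trans (le_rpow_of_le_mul_rpow hpq hyv0 h4)
  set R : Set ℝ := (fun t => y t / (s - t) ^ p') '' Ico a s with hR
  have hRb : BddAbove R := ⟨(p' * k) ^ p', by rintro _ ⟨t, ht, rfl⟩; exact hbound t ht⟩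
  have hRne : R.Nonempty := ⟨_, mem_image_of_mem _ ⟨le_rfl, has⟩⟩
  set A := sSup R with hA
  have hratio : ∀ t ∈ Ico a s, y t ≤ A * (s - t) ^ p' := fun t ht => by
    have := sub_pos.2 ht.2
    rw [← div_le_iff₀ (by positivity)]
    exact le_csSup hRb (mem_image_of_mem _ ht)
  have hA0 : 0 < A := by
    have h1 := sub_pos.2 has
    have h2 := hpos a ⟨le_rfl, has⟩
    have h3 : y a / (s - a) ^ p' ≤ A := le_csSup hRb (mem_image_of_mem _ ⟨le_rfl, has⟩)
    exact lt_of_lt_of_le (by positivity) h3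
  have hexp : p' * (1 / p) = p' - 1 := by
    rw [mul_one_div]; exact hpq.symm.div_conj_eq_sub_one
  have himp : A ≤ k * A ^ (1 / p) - ν := by
    refine csSup_le hRne ?_
    rintro _ ⟨t, ht, rfl⟩
    have hst : 0 < s - t := sub_pos.2 ht.2
    have htI : t ∈ Icc a s := Ico_subset_Icc_self ht
    change y t / (s - t) ^ p' ≤ _
    rw [div_le_iff₀ (by positivity), ← integral_mul_sub_rpow hp',
      ← intervalIntegral.integral_const_mul]
    refine (hle t htI).trans (intervalIntegral.integral_mono_on_of_le_Ioo ht.2.le (hint t htI)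
      ?_ fun u hu => ?_)
    · refine ContinuousOn.intervalIntegrable ?_
      have h2 : ContinuousOn (fun u => (s - u) ^ (p' - 1)) (uIcc t s) :=
        (by fun_prop : ContinuousOn (fun u => s - u) (uIcc t s)).rpow_const
          fun _ _ => Or.inr hq.le
      fun_prop
    · have huI : u ∈ Ico a s := ⟨ht.1.trans hu.1.le, hu.2⟩
      have hsu : 0 < s - u := sub_pos.2 hu.2
      have h1 : y u ^ (1 / p) ≤ A ^ (1 / p) * (s - u) ^ (p' - 1) := by
        rw [← hexp, Real.rpow_mul hsu.le, ← Real.mul_rpow hA0.le (by positivity)]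
        exact Real.rpow_le_rpow (hpos u huI).le (hratio u huI) (by positivity)
      rw [show (k * A ^ (1 / p) - ν) * (p' * (s - u) ^ (p' - 1)) =
        p' * (k * (A ^ (1 / p) * (s - u) ^ (p' - 1)) - ν * (s - u) ^ (p' - 1)) by ring]
      gcongr
  linarith [mul_rpow_lt_add_of_lt hpq hν hA0 hk]

lemma intervalIntegrable_caraSol_integrand {p p' s c M : ℝ} {h f y : ℝ → ℝ} (hp : 0 < p)
    (hs : s ∈ Ioo (0 : ℝ) 1) (hmeas : Measurable h) (hM : ∀ t ∈ Icc (0 : ℝ) 1, |h t| ≤ M)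
    (hf : IntegrableOn f (Ioo (0 : ℝ) 1)) (hy : ContinuousOn y (Icc 0 s)) :
    IntervalIntegrable (fun u => p' * ((c - h u) * (max (y u) 0) ^ (1 / p) - f u)) volume 0 s := by
  have h1 : ContinuousOn (fun u => (max (y u) 0) ^ (1 / p)) (uIcc 0 s) := by
    rw [uIcc_of_le hs.1.le]
    exact (ContinuousOn.sup hy continuousOn_const).rpow_const fun _ _ => Or.inr (by positivity)
  have hh : IntervalIntegrable h volume 0 s := by
    rw [intervalIntegrable_iff_integrableOn_Ioc_of_le hs.1.le]
    refine IntegrableOn.of_bound (by simp) hmeas.aestronglyMeasurable M ?_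
    refine ae_restrict_of_forall_mem measurableSet_Ioc fun t ht => ?_
    exact hM t ⟨ht.1.le, ht.2.trans hs.2.le⟩
  have hf' : IntervalIntegrable f volume 0 s := by
    rw [intervalIntegrable_iff_integrableOn_Ioc_of_le hs.1.le]
    exact hf.mono_set fun t ht => ⟨ht.1, ht.2.trans_lt hs.2⟩
  exact (((intervalIntegrable_const.sub hh).mul_continuousOn h1).sub hf').const_mul p'

lemma not_exists_isPosBVPSol {p p' s c ν M : ℝ} {h f : ℝ → ℝ} (hpq : p.HolderConjugate p')
    (hs : s ∈ Ioo (0 : ℝ) 1) (hmeas : Measurable h) (hM : ∀ t ∈ Icc (0 : ℝ) 1, |h t| ≤ M)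
    (hf : IntegrableOn f (Ioo (0 : ℝ) 1)) (hhc : ContinuousAt h s) (hc : c < h s) (hν : 0 < ν)
    (hνle : (ν : EReal) ≤ liminf (fun t => ((-f t / (s - t) ^ (p' - 1) : ℝ) : EReal)) (𝓝[<] s))
    (hcν : h s - p' ^ (1 / p') * p ^ (1 / p) * ν ^ (1 / p') < c) :
    ¬ ∃ y, IsPosBVPSol p p' h f c 0 s y := by
  rintro ⟨y, ⟨hy, hsol⟩, -, hys, hpos⟩
  have hp' := hpq.symm.pos
  obtain ⟨μ, hμ, hμν, hμ0⟩ : ∃ μ, h s - c < p' ^ (1 / p') * p ^ (1 / p) * μ ^ (1 / p') ∧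
      μ < ν ∧ 0 < μ := by
    have hcont : ContinuousAt (fun μ : ℝ => p' ^ (1 / p') * p ^ (1 / p) * μ ^ (1 / p')) ν :=
      (Real.continuousAt_rpow_const ν _ (Or.inl hν.ne')).const_mul _
    have h1 := (hcont.eventually (lt_mem_nhds
      (show h s - c < p' ^ (1 / p') * p ^ (1 / p) * ν ^ (1 / p') by linarith))).filter_mono
        (nhdsWithin_le_nhds (s := Iio ν))
    have h2 : ∀ᶠ μ in 𝓝[<] ν, 0 < μ := nhdsWithin_le_nhds (lt_mem_nhds hν)
    exact (h1.and ((eventually_mem_nhdsWithin (s := Iio ν)).and h2)).exists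
  obtain ⟨k, hk1, hk2⟩ := exists_between hμ
  have hlim : ∀ᶠ t in 𝓝[<] s, (μ : EReal) < ((-f t / (s - t) ^ (p' - 1) : ℝ) : EReal) :=
    eventually_lt_of_lt_liminf ((EReal.coe_lt_coe_iff.2 hμν).trans_le hνle)
  have hcont : ∀ᶠ t in 𝓝[<] s, h t < c + k :=
    nhdsWithin_le_nhds (hhc.eventually (gt_mem_nhds (by linarith)))
  obtain ⟨b, hb, hbs⟩ := (mem_nhdsLT_iff_exists_Ioo_subset' hs.1).1 (hlim.and hcont)
  obtain ⟨a, hba, has⟩ := exists_between (max_lt hb hs.1)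
  have ha0 : 0 < a := (le_max_right _ _).trans_lt hba
  have hab : b < a := (le_max_left _ _).trans_lt hba
  have hint := intervalIntegrable_caraSol_integrand (p' := p') (c := c) hpq.pos hs hmeas hM hf hy
  refine not_forall_le_integral hpq hμ0 (by linarith) hk2 has
    (hy.mono (Icc_subset_Icc_left ha0.le)) (fun t ht => hpos t ⟨ha0.trans_le ht.1, ht.2⟩) hys ?_
  intro t ht
  have ht0 : t ∈ Icc 0 s := ⟨ha0.le.trans ht.1, ht.2⟩
  have hint0 := hint.mono_set (c := 0) (d := t)
    (by rw [uIcc_of_le ht0.1, uIcc_of_le hs.1.le]; exact Icc_subset_Icc_right ht.2)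
  have hint1 := hint.mono_set (c := t) (d := s)
    (by rw [uIcc_of_le ht0.2, uIcc_of_le hs.1.le]; exact Icc_subset_Icc_left ht0.1)
  have hadd := intervalIntegral.integral_add_adjacent_intervals hint0 hint1
  have e1 := hsol t ht0
  have e2 := hsol s ⟨hs.1.le, le_rfl⟩
  have hyt : y t = ∫ u in t..s, -(p' * ((c - h u) * (max (y u) 0) ^ (1 / p) - f u)) := by
    rw [intervalIntegral.integral_neg]
    linarith
  rw [hyt]
  refine intervalIntegral.integral_mono_on_of_le_Ioo ht.2 hint1.neg ?_ fun u hu => ?_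
  · refine ContinuousOn.intervalIntegrable ?_
    rw [uIcc_of_le ht.2]
    have h1 : ContinuousOn (fun u => y u ^ (1 / p)) (Icc t s) :=
      (hy.mono (Icc_subset_Icc_left ht0.1)).rpow_const
        fun _ _ => Or.inr (one_div_nonneg.2 hpq.pos.le)
    have h2 : ContinuousOn (fun u => (s - u) ^ (p' - 1)) (Icc t s) :=
      (by fun_prop : ContinuousOn (fun u => s - u) (Icc t s)).rpow_const
        fun _ _ => Or.inr (by linarith [hpq.symm.lt])
    fun_prop
  · obtain ⟨hfu, hhu⟩ := hbs ⟨hab.trans_le (ht.1.trans hu.1.le), hu.2⟩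
    have hyu := hpos u ⟨ht0.1.trans_lt hu.1, hu.2⟩
    have hsu : 0 < s - u := sub_pos.2 hu.2
    have hfu' : μ * (s - u) ^ (p' - 1) < -f u :=
      (lt_div_iff₀ (by positivity)).1 (EReal.coe_lt_coe_iff.1 hfu)
    rw [max_eq_left hyu.le, ← mul_neg]
    have hyp : 0 ≤ y u ^ (1 / p) := by positivity
    gcongr
    nlinarith [mul_le_mul_of_nonneg_right (show h u - c ≤ k by linarith) hyp]

theorem stmt_10
    (p p' s : ℝ) (h f : ℝ → ℝ)
    (hp : 1 < p) (hp'def : p' = p / (p - 1))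
    (hs : s ∈ Set.Ioo (0:ℝ) 1)
    (hmeas : Measurable h)
    (hbd : ∃ M : ℝ, ∀ t ∈ Set.Icc (0:ℝ) 1, |h t| ≤ M)
    (hfint : MeasureTheory.IntegrableOn f (Set.Ioo (0:ℝ) 1))
    (hf0 : f 0 = 0) (hfs : f s = 0) (hf1 : f 1 = 0)
    (hfneg : ∀ t ∈ Set.Ioo (0:ℝ) s, f t < 0)
    (hfpos : ∀ t ∈ Set.Ioo s (1:ℝ), 0 < f t)
    (husc : UpperSemicontinuousOn f (Set.Ioo (0:ℝ) s))
    (hlsc : LowerSemicontinuousOn f (Set.Ioo s (1:ℝ)))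
    (hhc : ContinuousAt h s)
    (hhfin : ∃ S : Finset ℝ, ContinuousOn h (Set.Icc (0:ℝ) 1 \ ↑S))
    (hν : 0 < Filter.liminf (fun t => ((-f t / (s - t) ^ (p' - 1) : ℝ) : EReal)) (𝓝[<] s)) :
    (∀ c : ℝ, c < h s →
      (∃ ν : ℝ, 0 < ν ∧
        (ν : EReal) ≤ Filter.liminf (fun t => ((-f t / (s - t) ^ (p' - 1) : ℝ) : EReal)) (𝓝[<] s) ∧
        h s - p' ^ (1 / p') * p ^ (1 / p) * ν ^ (1 / p') < c) →
      ¬ ∃ y, IsPosBVPSol p p' h f c 0 s y) ∧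
    (Filter.liminf (fun t => ((-f t / (s - t) ^ (p' - 1) : ℝ) : EReal)) (𝓝[<] s) = ⊤ →
      ∀ c : ℝ, c < h s → ¬ ∃ y, IsPosBVPSol p p' h f c 0 s y) := by
  have hpq : p.HolderConjugate p' := Real.holderConjugate_iff_eq_conjExponent hp |>.2 hp'def
  obtain ⟨M, hM⟩ := hbd
  refine ⟨fun c hc ⟨ν, hν0, hνle, hcν⟩ =>
    not_exists_isPosBVPSol hpq hs hmeas hM hfint hhc hc hν0 hνle hcν, fun htop c hc => ?_⟩
  have hp0 := hpq.pos
  have hp'0 := hpq.symm.pos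
  have hlim : Tendsto (fun ν : ℝ => p' ^ (1 / p') * p ^ (1 / p) * ν ^ (1 / p')) atTop atTop :=
    (tendsto_rpow_atTop (by positivity)).const_mul_atTop (by positivity)
  obtain ⟨ν, hν1, hν0⟩ := ((hlim.eventually_gt_atTop (h s - c)).and (eventually_gt_atTop 0)).exists
  exact not_exists_isPosBVPSol hpq hs hmeas hM hfint hhc hc hν0 (htop ▸ le_top) (by linarith)
end
end

section
/- Assume (H3) and ν̂ > 0, where ν̂ = liminf_{t → s_*⁺} f(t)/(t − s_*)^{p'−1} ∈ (0, ∞]. If c ∈ ℝ satisfies h(s_*) < c < h(s_*) + (p')^{1/p'} p^{1/p} ν̂^{1/p'} (the right-hand bound being interpreted as +∞ when ν̂ = ∞), then the boundary value problem on [s_*, 1] admits no positive solution. In particular, if ν̂ = ∞, then there is no positive solution for any c > h(s_*). -/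
open MeasureTheory Set Filter Topology intervalIntegral

noncomputable section

/-- Quantitative Young inequality behind the threshold `p'^(1/p') * p^(1/p) * ν^(1/p')`. -/
theorem exists_pos_forall_mul_rpow_sub_le {p p' K ν : ℝ} (hpq : p.HolderConjugate p')
    (hK : 0 ≤ K) (hν : 0 < ν) (hlt : K < p' ^ (1 / p') * p ^ (1 / p) * ν ^ (1 / p')) :
    ∃ η > 0, ∀ B : ℝ, 0 ≤ B → K * B ^ (1 / p) - ν ≤ B - η := by
  have hp := hpq.pos
  have hp' := hpq.symm.pos
  have hpp : 0 < p ^ (1 / p) := Real.rpow_pos_of_pos hp _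
  have hdiv : (K / p ^ (1 / p)) ^ p' < p' * ν := by
    have h1 : K / p ^ (1 / p) < (p' * ν) ^ (1 / p') := by
      rw [div_lt_iff₀ hpp, Real.mul_rpow hp'.le hν.le]
      linarith
    have h2 := Real.rpow_lt_rpow (div_nonneg hK hpp.le) h1 hp'
    rwa [← Real.rpow_mul (by positivity), one_div_mul_cancel hp'.ne', Real.rpow_one] at h2
  refine ⟨ν - (K / p ^ (1 / p)) ^ p' / p', ?_, fun B hB => ?_⟩
  · rw [gt_iff_lt, sub_pos, div_lt_iff₀ hp']
    linarith
  · have hY := Real.young_inequality_of_nonneg (a := (p * B) ^ (1 / p))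
      (b := K / p ^ (1 / p)) (by positivity) (by positivity) hpq
    rw [← Real.rpow_mul (by positivity), one_div_mul_cancel hp.ne', Real.rpow_one,
      Real.mul_rpow hp.le hB, mul_div_cancel_left₀ _ hp.ne'] at hY
    have : p ^ (1 / p) * B ^ (1 / p) * (K / p ^ (1 / p)) = K * B ^ (1 / p) := by
      field_simp
    linarith

theorem integral_sub_rpow_sub_one {q s t : ℝ} (hq : 0 < q) :
    ∫ u in s..t, (u - s) ^ (q - 1) = (t - s) ^ q / q := by
  rw [intervalIntegral.integral_comp_sub_right (fun x => x ^ (q - 1)) s,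
    integral_rpow (Or.inl (by linarith))]
  simp [Real.zero_rpow hq.ne']

theorem intervalIntegrable_sub_rpow_sub_one {q s t : ℝ} (hq : 0 < q) :
    IntervalIntegrable (fun u => (u - s) ^ (q - 1)) volume s t := by
  have h := (intervalIntegral.intervalIntegrable_rpow' (a := 0) (b := t - s)
    (r := q - 1) (by linarith)).comp_sub_right s
  simpa using h

/-- A subsolution bounded by `B * (t - s) ^ p'` improves its own bound at each application of the
integral inequality, so it cannot stay positive. -/
theorem not_forall_pos_of_integral_le {p p' K ν s b : ℝ} {y g : ℝ → ℝ}
    (hpq : p.HolderConjugate p') (hK : 0 ≤ K) (hν : 0 < ν)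
    (hlt : K < p' ^ (1 / p') * p ^ (1 / p) * ν ^ (1 / p')) (hsb : s < b)
    (hy : ContinuousOn y (Icc s b)) (hys : y s = 0)
    (hint : ∀ t ∈ Ioc s b, IntervalIntegrable g volume s t)
    (heq : ∀ t ∈ Ioc s b, y t = ∫ u in s..t, g u)
    (hg : ∀ u ∈ Ioo s b, g u ≤ p' * (K * y u ^ (1 / p) - ν * (u - s) ^ (p' - 1))) :
    ¬ ∀ t ∈ Ioc s b, 0 < y t := by
  intro hpos
  have hp := hpq.pos
  have hp' := hpq.symm.pos
  have hexp : p' * (1 / p) = p' - 1 := by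
    have := hpq.symm.sub_one_mul_conj
    field_simp
    linarith
  have hinv : 1 / p' = 1 - 1 / p := by
    have := hpq.inv_add_inv_eq_one
    simp only [one_div]
    linarith
  obtain ⟨η, hη, hstep⟩ := exists_pos_forall_mul_rpow_sub_le hpq hK hν hlt
  have hinit : ∀ t ∈ Ioc s b, y t ≤ (p' * K) ^ p' * (t - s) ^ p' := by
    intro t ht
    obtain ⟨m, hm, hmax⟩ := isCompact_Icc.exists_isMaxOn (nonempty_Icc.2 ht.1.le)
      (hy.mono (Icc_subset_Icc_right ht.2))
    have hty : y t ≤ y m := hmax (right_mem_Icc.2 ht.1.le)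
    have hm0 : 0 < y m := (hpos t ht).trans_le hty
    have hsm : s < m := hm.1.lt_of_ne fun h => by simp [← h, hys] at hm0
    have hmb : m ∈ Ioc s b := ⟨hsm, hm.2.trans ht.2⟩
    have h1 : y m ≤ ∫ _ in s..m, p' * K * y m ^ (1 / p) := by
      rw [heq m hmb]
      refine intervalIntegral.integral_mono_on_of_le_Ioo hsm.le (hint m hmb) (by simp) ?_
      intro u hu
      rw [← heq m hmb]
      have hub : u ∈ Ioo s b := ⟨hu.1, hu.2.trans_le hmb.2⟩
      have h2 : y u ^ (1 / p) ≤ y m ^ (1 / p) :=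
        Real.rpow_le_rpow (hpos u ⟨hub.1, hub.2.le⟩).le
          (hmax ⟨hu.1.le, hu.2.le.trans hm.2⟩) (by positivity)
      have h3 : 0 ≤ ν * (u - s) ^ (p' - 1) :=
        mul_nonneg hν.le (Real.rpow_nonneg (by linarith [hu.1]) _)
      calc g u ≤ p' * (K * y u ^ (1 / p) - ν * (u - s) ^ (p' - 1)) := hg u hub
        _ ≤ p' * (K * y m ^ (1 / p)) := by
          gcongr
          nlinarith [mul_le_mul_of_nonneg_left h2 hK]
        _ = _ := by ring
    rw [intervalIntegral.integral_const, smul_eq_mul] at h1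
    have hr : 0 < y m ^ (1 / p) := Real.rpow_pos_of_pos hm0 _
    have h4 : y m ^ (1 / p') ≤ p' * K * (t - s) := by
      rw [hinv, Real.rpow_sub hm0, Real.rpow_one, div_le_iff₀ hr]
      calc y m ≤ (m - s) * (p' * K * y m ^ (1 / p)) := h1
        _ ≤ (t - s) * (p' * K * y m ^ (1 / p)) := by
          gcongr
          exact hm.2
        _ = _ := by ring
    have h5 := Real.rpow_le_rpow (by positivity) h4 hp'.le
    rw [← Real.rpow_mul hm0.le, one_div_mul_cancel hp'.ne', Real.rpow_one,
      Real.mul_rpow (by positivity) (by linarith [ht.1])] at h5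
    exact hty.trans h5
  have hiter : ∀ n : ℕ, ∀ t ∈ Ioc s b, y t ≤ ((p' * K) ^ p' - n * η) * (t - s) ^ p' := by
    intro n
    induction n with
    | zero => simpa using hinit
    | succ n ih =>
      intro t ht
      set B := (p' * K) ^ p' - n * η with hBdef
      have hτ : 0 < (t - s) ^ p' := Real.rpow_pos_of_pos (by linarith [ht.1]) _
      have hB : 0 ≤ B := (pos_of_mul_pos_left ((hpos t ht).trans_le (ih t ht)) hτ.le).le
      have h1 : y t ≤ ∫ u in s..t, p' * (K * B ^ (1 / p) - ν) * (u - s) ^ (p' - 1) := by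
        rw [heq t ht]
        refine intervalIntegral.integral_mono_on_of_le_Ioo ht.1.le (hint t ht)
          ((intervalIntegrable_sub_rpow_sub_one hp').const_mul _) ?_
        intro u hu
        have hub : u ∈ Ioo s b := ⟨hu.1, hu.2.trans_le ht.2⟩
        have hu0 : 0 ≤ u - s := by linarith [hu.1]
        have h2 := Real.rpow_le_rpow (hpos u ⟨hub.1, hub.2.le⟩).le (ih u ⟨hub.1, hub.2.le⟩)
          (by positivity : 0 ≤ 1 / p)
        rw [Real.mul_rpow hB (by positivity), ← Real.rpow_mul hu0, hexp] at h2
        calc g u ≤ p' * (K * y u ^ (1 / p) - ν * (u - s) ^ (p' - 1)) := hg u hub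
          _ ≤ p' * (K * (B ^ (1 / p) * (u - s) ^ (p' - 1)) - ν * (u - s) ^ (p' - 1)) := by
            gcongr
          _ = _ := by ring
      rw [intervalIntegral.integral_const_mul, integral_sub_rpow_sub_one hp'] at h1
      calc y t ≤ (K * B ^ (1 / p) - ν) * (t - s) ^ p' := by
            refine h1.trans_eq ?_
            field_simp
        _ ≤ (B - η) * (t - s) ^ p' :=
            mul_le_mul_of_nonneg_right (hstep B hB) hτ.le
        _ = _ := by
            rw [hBdef]
            push_cast
            ring
  obtain ⟨n, hn⟩ := exists_nat_gt ((p' * K) ^ p' / η)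
  rw [div_lt_iff₀ hη] at hn
  have hbm : b ∈ Ioc s b := right_mem_Ioc.2 hsb
  have hτ : 0 < (b - s) ^ p' := Real.rpow_pos_of_pos (by linarith) _
  nlinarith [hiter n b hbm, hpos b hbm]

theorem intervalIntegrable_caratheodory_rhs {p p' c M s t : ℝ} {h f y : ℝ → ℝ} (hp : 0 ≤ p)
    (hs : 0 ≤ s) (hst : s ≤ t) (ht : t ≤ 1) (hmeas : Measurable h)
    (hM : ∀ t ∈ Icc (0 : ℝ) 1, |h t| ≤ M) (hf : IntegrableOn f (Ioo (0 : ℝ) 1))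
    (hy : ContinuousOn y (Icc s t)) :
    IntervalIntegrable (fun u => p' * ((c - h u) * (max (y u) 0) ^ (1 / p) - f u))
      volume s t := by
  have hf' : IntervalIntegrable f volume s t := by
    rw [intervalIntegrable_iff_integrableOn_Ioo_of_le hst]
    exact hf.mono_set (Ioo_subset_Ioo hs ht)
  have hh : IntervalIntegrable (fun u => c - h u) volume s t := by
    rw [intervalIntegrable_iff_integrableOn_Icc_of_le hst]
    refine Measure.integrableOn_of_bounded (M := |c| + M) (by simp)
      (measurable_const.sub hmeas).aestronglyMeasurable ?_
    filter_upwards [ae_restrict_mem measurableSet_Icc] with u hu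
    exact (abs_sub _ _).trans (by linarith [hM u ⟨hs.trans hu.1, hu.2.trans ht⟩])
  have hr : ContinuousOn (fun u => (max (y u) 0) ^ (1 / p)) (uIcc s t) := by
    rw [uIcc_of_le hst]
    exact (hy.sup continuousOn_const).rpow_const fun _ _ => Or.inr (by positivity)
  exact ((hh.mul_continuousOn hr).sub hf').const_mul p'

theorem stmt_12
    (p p' s : ℝ) (h f : ℝ → ℝ)
    (hp : 1 < p) (hp'def : p' = p / (p - 1))
    (hs : s ∈ Set.Ioo (0:ℝ) 1)
    (hmeas : Measurable h)
    (hbd : ∃ M : ℝ, ∀ t ∈ Set.Icc (0:ℝ) 1, |h t| ≤ M)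
    (hfint : MeasureTheory.IntegrableOn f (Set.Ioo (0:ℝ) 1))
    (hf0 : f 0 = 0) (hfs : f s = 0) (hf1 : f 1 = 0)
    (hfneg : ∀ t ∈ Set.Ioo (0:ℝ) s, f t < 0)
    (hfpos : ∀ t ∈ Set.Ioo s (1:ℝ), 0 < f t)
    (husc : UpperSemicontinuousOn f (Set.Ioo (0:ℝ) s))
    (hlsc : LowerSemicontinuousOn f (Set.Ioo s (1:ℝ)))
    (hhc : ContinuousAt h s)
    (hhfin : ∃ S : Finset ℝ, ContinuousOn h (Set.Icc (0:ℝ) 1 \ ↑S))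
    (hν : 0 < Filter.liminf (fun t => ((f t / (t - s) ^ (p' - 1) : ℝ) : EReal)) (𝓝[>] s)) :
    (∀ c : ℝ, h s < c →
      (∃ ν : ℝ, 0 < ν ∧
        (ν : EReal) ≤ Filter.liminf (fun t => ((f t / (t - s) ^ (p' - 1) : ℝ) : EReal)) (𝓝[>] s) ∧
        c < h s + p' ^ (1 / p') * p ^ (1 / p) * ν ^ (1 / p')) →
      ¬ ∃ y, IsPosBVPSol p p' h f c s 1 y) ∧
    (Filter.liminf (fun t => ((f t / (t - s) ^ (p' - 1) : ℝ) : EReal)) (𝓝[>] s) = ⊤ →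
      ∀ c : ℝ, h s < c → ¬ ∃ y, IsPosBVPSol p p' h f c s 1 y) := by
  have hpq : p.HolderConjugate p' := (Real.holderConjugate_iff_eq_conjExponent hp).2 hp'def
  have hp' := hpq.symm.pos
  have hp0 := hpq.pos
  have key : ∀ c : ℝ, h s < c →
      (∃ ν : ℝ, 0 < ν ∧
        (ν : EReal) ≤ Filter.liminf (fun t => ((f t / (t - s) ^ (p' - 1) : ℝ) : EReal)) (𝓝[>] s) ∧
        c < h s + p' ^ (1 / p') * p ^ (1 / p) * ν ^ (1 / p')) →
      ¬ ∃ y, IsPosBVPSol p p' h f c s 1 y := by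
    rintro c hc ⟨ν, hν0, hνle, hcν⟩ ⟨y, ⟨hyc, hyeq⟩, hys, -, hypos⟩
    obtain ⟨M, hM⟩ := hbd
    obtain ⟨ν₁, hν₁, hν₁0, hν₁ν⟩ : ∃ ν₁ : ℝ,
        c - h s < p' ^ (1 / p') * p ^ (1 / p) * ν₁ ^ (1 / p') ∧ 0 < ν₁ ∧ ν₁ < ν := by
      have hcont : ContinuousAt (fun x : ℝ => p' ^ (1 / p') * p ^ (1 / p) * x ^ (1 / p')) ν :=
        continuousAt_const.mul (Real.continuousAt_rpow_const _ _ (Or.inl hν0.ne'))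
      have h1 := (hcont.eventually (lt_mem_nhds (by linarith : c - h s < _))).filter_mono
        (nhdsWithin_le_nhds (s := Iio ν))
      exact (h1.and (Ioo_mem_nhdsLT hν0)).exists
    obtain ⟨K, hcK, hK⟩ := exists_between hν₁
    have hf_lt : ∀ᶠ t in 𝓝[>] s, ν₁ < f t / (t - s) ^ (p' - 1) := by
      have h1 : (ν₁ : EReal) <
          liminf (fun t => ((f t / (t - s) ^ (p' - 1) : ℝ) : EReal)) (𝓝[>] s) :=
        (EReal.coe_lt_coe_iff.2 hν₁ν).trans_le hνle
      filter_upwards [eventually_lt_of_lt_liminf h1] with t ht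
      exact EReal.coe_lt_coe_iff.1 ht
    have hh_lt : ∀ᶠ t in 𝓝[>] s, c - h t < K :=
      ((continuousAt_const.sub hhc).eventually (gt_mem_nhds hcK)).filter_mono nhdsWithin_le_nhds
    obtain ⟨b₀, hb₀, hsub⟩ := mem_nhdsGT_iff_exists_Ioo_subset.1 (hf_lt.and hh_lt)
    obtain ⟨b, hsb, hbmin⟩ := exists_between (lt_min (mem_Ioi.1 hb₀) hs.2)
    have hbb₀ := hbmin.trans_le (min_le_left _ _)
    have hb1 := hbmin.trans_le (min_le_right _ _)
    have hpos : ∀ t ∈ Ioc s b, 0 < y t := fun t ht => hypos t ⟨ht.1, ht.2.trans_lt hb1⟩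
    refine not_forall_pos_of_integral_le hpq (by linarith) hν₁0 hK hsb
      (hyc.mono (Icc_subset_Icc_right hb1.le)) hys
      (g := fun u => p' * ((c - h u) * (max (y u) 0) ^ (1 / p) - f u))
      (fun t ht => intervalIntegrable_caratheodory_rhs hp0.le hs.1.le ht.1.le
        (ht.2.trans hb1.le) hmeas hM hfint
        (hyc.mono (Icc_subset_Icc_right (ht.2.trans hb1.le)))) ?_ ?_ hpos
    · intro t ht
      simpa [hys] using hyeq t ⟨ht.1.le, ht.2.trans hb1.le⟩
    · intro u hu
      obtain ⟨h1, h2⟩ := hsub ⟨hu.1, hu.2.trans hbb₀⟩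
      have hyu := hpos u ⟨hu.1, hu.2.le⟩
      rw [lt_div_iff₀ (Real.rpow_pos_of_pos (by linarith [hu.1]) _)] at h1
      simp only [max_eq_left hyu.le]
      gcongr
  refine ⟨key, fun htop c hc => key c hc ?_⟩
  have hlim : Tendsto (fun x : ℝ => p' ^ (1 / p') * p ^ (1 / p) * x ^ (1 / p')) atTop atTop :=
    (tendsto_rpow_atTop (by positivity)).const_mul_atTop (by positivity)
  obtain ⟨ν, hν1, hν0⟩ := ((hlim.eventually_gt_atTop (c - h s)).and (eventually_gt_atTop 0)).exists
  exact ⟨ν, hν0, by simp [htop], by linarith⟩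
end
end
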